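/- For every k ∈ ℕ, every finite graph G has a good tree-decomposition (canonical, of adhesion < k, distinguishing every two distinct k-blocks efficiently) that includes among its parts every k-block of G that occurs as a part in some tree-decomposition of G of adhesion < k. -/

import Mathlib

open SimpleGraph Set

namespace CanonicalTD

variable {V : Type*} {ι : Type*}

/-- `p = (A,B)` is a separation of `G`: `A ∪ B = V` and no edge between `A∖B` and `B∖A`. -/
def IsSep (G : SimpleGraph V) (p : Set V × Set V) : Prop :=
  p.1 ∪ p.2 = univ ∧ ∀ a ∈ p.1 \ p.2, ∀ b ∈ p.2 \ p.1, ¬G.Adj a b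

/-- The order `|A ∩ B|` of a separation `(A,B)`. -/
noncomputable def sepOrder (p : Set V × Set V) : ℕ := (p.1 ∩ p.2).ncard

/-- A separation is proper if both `A∖B` and `B∖A` are nonempty. -/
def ProperSep (p : Set V × Set V) : Prop := (p.1 \ p.2).Nonempty ∧ (p.2 \ p.1).Nonempty

/-- The partial order on separations: `(A,B) ≤ (C,D)` iff `A ⊆ C` and `D ⊆ B`. -/
def SepLE (p q : Set V × Set V) : Prop := p.1 ⊆ q.1 ∧ q.2 ⊆ p.2

/-- Two separations are nested if they become comparable after possibly inverting. -/
def Nested (p q : Set V × Set V) : Prop :=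
  SepLE p q ∨ SepLE q p ∨ SepLE p q.swap ∨ SepLE q.swap p

/-- A separation `(A,B)` is tight if every vertex of `A ∩ B` has a neighbour in `A∖B`
and a neighbour in `B∖A`. -/
def TightSep (G : SimpleGraph V) (p : Set V × Set V) : Prop :=
  ∀ v ∈ p.1 ∩ p.2, (∃ a ∈ p.1 \ p.2, G.Adj v a) ∧ ∃ b ∈ p.2 \ p.1, G.Adj v b

/-- `S_k`: the set of all proper separations of `G` of order `< k`. -/
def Sk (G : SimpleGraph V) (k : ℕ) : Set (Set V × Set V) :=
  {p | IsSep G p ∧ ProperSep p ∧ sepOrder p < k}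

/-- A separation system of `G`: a set of separations closed under inverses. -/
def IsSepSystem (G : SimpleGraph V) (N : Set (Set V × Set V)) : Prop :=
  (∀ p ∈ N, IsSep G p) ∧ ∀ p ∈ N, p.swap ∈ N

def NestedSystem (N : Set (Set V × Set V)) : Prop :=
  ∀ p ∈ N, ∀ q ∈ N, Nested p q

def ProperSystem (N : Set (Set V × Set V)) : Prop := ∀ p ∈ N, ProperSep p

/-- An orientation of `N`: contains exactly one of `(A,B)`, `(B,A)` for each `(A,B) ∈ N`. -/
def IsOrientation (N O : Set (Set V × Set V)) : Prop :=
  O ⊆ N ∧ ∀ p ∈ N, (p ∈ O ↔ p.swap ∉ O)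

/-- Consistency: no distinct `(A,B),(C,D) ∈ O` with `(D,C) ≤ (A,B)`. -/
def Consistent (O : Set (Set V × Set V)) : Prop :=
  ∀ p ∈ O, ∀ q ∈ O, p ≠ q → ¬SepLE q.swap p

/-- A `k`-profile of `G`. -/
def IsProfile (G : SimpleGraph V) (k : ℕ) (P : Set (Set V × Set V)) : Prop :=
  IsOrientation (Sk G k) P ∧ Consistent P ∧
    ∀ p ∈ P, ∀ q ∈ P, (p.2 ∩ q.2, p.1 ∪ q.1) ∉ P

/-- `(T, Vt)` is a tree-decomposition of `G`. -/
def IsTreeDecomp (G : SimpleGraph V) (T : SimpleGraph ι) (Vt : ι → Set V) : Prop :=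
  T.IsTree ∧ (⋃ t, Vt t) = univ ∧
  (∀ u v, G.Adj u v → ∃ t, u ∈ Vt t ∧ v ∈ Vt t) ∧
  ∀ (t1 t3 : ι) (w : T.Walk t1 t3), w.IsPath →
    ∀ t2 ∈ w.support, Vt t1 ∩ Vt t3 ⊆ Vt t2

/-- The vertex set of the component of `T - t1t2` containing `t1`. -/
def side (T : SimpleGraph ι) (t1 t2 : ι) : Set ι :=
  {s | (T.deleteEdges {s(t1, t2)}).Reachable t1 s}

/-- The separation induced by the oriented edge `(t1, t2)` of `T`. -/
def inducedSep (T : SimpleGraph ι) (Vt : ι → Set V) (t1 t2 : ι) : Set V × Set V :=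
  (⋃ s ∈ side T t1 t2, Vt s, ⋃ s ∈ side T t2 t1, Vt s)

/-- The set of separations induced by oriented edges of `T`. -/
def inducedSeps (T : SimpleGraph ι) (Vt : ι → Set V) : Set (Set V × Set V) :=
  {p | ∃ t1 t2, T.Adj t1 t2 ∧ p = inducedSep T Vt t1 t2}

/-- `O(t)`: separations induced by oriented edges `(t1,t2)` with `t` in the component of `t2`. -/
def Otow (T : SimpleGraph ι) (Vt : ι → Set V) (t : ι) : Set (Set V × Set V) :=
  {p | ∃ t1 t2, T.Adj t1 t2 ∧ t ∈ side T t2 t1 ∧ p = inducedSep T Vt t1 t2}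

/-- The map assigning to each oriented edge of `T` its induced separation is a bijection
onto `N`. -/
def EdgeSepBij (T : SimpleGraph ι) (Vt : ι → Set V) (N : Set (Set V × Set V)) : Prop :=
  (∀ t1 t2, T.Adj t1 t2 → inducedSep T Vt t1 t2 ∈ N) ∧
  ∀ p ∈ N, ∃! e : ι × ι, T.Adj e.1 e.2 ∧ inducedSep T Vt e.1 e.2 = p

/-- The tree-decomposition has adhesion `< k`. -/
def AdhesionLt (T : SimpleGraph ι) (Vt : ι → Set V) (k : ℕ) : Prop :=
  ∀ t1 t2, T.Adj t1 t2 → (Vt t1 ∩ Vt t2).ncard < k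

/-- The tree-decomposition is canonical: the automorphism group of `G` acts on `T`
compatibly with the parts. -/
def Canonical (G : SimpleGraph V) (T : SimpleGraph ι) (Vt : ι → Set V) : Prop :=
  ∃ ρ : (G ≃g G) → (T ≃g T),
    (∀ φ ψ : G ≃g G, ρ (φ.trans ψ) = (ρ φ).trans (ρ ψ)) ∧
    ∀ (φ : G ≃g G) (t : ι), (⇑φ) '' Vt t = Vt (ρ φ t)

/-- `X` is `(<k)`-inseparable in `G`. -/
def Inseparable' (G : SimpleGraph V) (k : ℕ) (X : Set V) : Prop :=
  ∀ p : Set V × Set V, IsSep G p → sepOrder p < k → X ⊆ p.1 ∨ X ⊆ p.2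

/-- `X` is a `k`-block of `G`: a maximal `(<k)`-inseparable set of at least `k` vertices. -/
def IsBlock (G : SimpleGraph V) (k : ℕ) (X : Set V) : Prop :=
  k ≤ X.ncard ∧ Inseparable' G k X ∧
    ∀ Y, Inseparable' G k Y → X ⊆ Y → Y = X

/-- The `k`-profile `P_k(X)` induced by a `k`-block `X`. -/
def blockProfile (G : SimpleGraph V) (k : ℕ) (X : Set V) : Set (Set V × Set V) :=
  {p | p ∈ Sk G k ∧ X ⊆ p.2 ∧ ¬X ⊆ p.1}

/-- `p` is a `≤`-maximal element of `M`. -/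
def MaxIn (M : Set (Set V × Set V)) (p : Set V × Set V) : Prop :=
  p ∈ M ∧ ∀ q ∈ M, SepLE p q → q = p

/-- The `k`-block `X` is well separated in `S`: the maximal elements of `P_k(X) ∩ S`
are pairwise nested. -/
def WellSepIn (G : SimpleGraph V) (k : ℕ) (X : Set V) (S : Set (Set V × Set V)) : Prop :=
  ∀ p q, MaxIn (blockProfile G k X ∩ S) p → MaxIn (blockProfile G k X ∩ S) q → Nested p q

/-- `D` is the vertex set of a component of `G - X`. -/
def IsCompOf (G : SimpleGraph V) (X D : Set V) : Prop :=
  D ⊆ Xᶜ ∧ (G.induce D).Connected ∧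
    ∀ D', D ⊆ D' → D' ⊆ Xᶜ → (G.induce D').Connected → D' = D

/-- `S(X)`: the set of tight separations `(A,B)` with `X ⊆ B` and `A∖B` the vertex set of
a component of `G - X`. -/
def SX (G : SimpleGraph V) (X : Set V) : Set (Set V × Set V) :=
  {p | IsSep G p ∧ TightSep G p ∧ X ⊆ p.2 ∧ IsCompOf G X (p.1 \ p.2)}

/-- `G` is `m`-connected. -/
def IsKConnected (G : SimpleGraph V) [Fintype V] (m : ℕ) : Prop :=
  m < Fintype.card V ∧ ∀ U : Set V, U.ncard < m → (G.induce Uᶜ).Connected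

/-- The tree-decomposition distinguishes the set `Profs` of profiles. -/
def DistinguishesProfiles (T : SimpleGraph ι) (Vt : ι → Set V)
    (Profs : Set (Set (Set V × Set V))) : Prop :=
  ∀ P ∈ Profs, ∀ P' ∈ Profs, P ≠ P' → ∃ p ∈ inducedSeps T Vt, p ∈ P ∧ p.swap ∈ P'

/-- The tree-decomposition distinguishes every two distinct `k`-blocks efficiently. -/
def DistinguishesBlocksEff (G : SimpleGraph V) (k : ℕ) (T : SimpleGraph ι)
    (Vt : ι → Set V) : Prop :=
  ∀ X X', IsBlock G k X → IsBlock G k X' → X ≠ X' →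
    ∃ p ∈ inducedSeps T Vt, X ⊆ p.1 ∧ X' ⊆ p.2 ∧
      ∀ q : Set V × Set V, IsSep G q → X ⊆ q.1 → X' ⊆ q.2 → sepOrder p ≤ sepOrder q

/-- An order-reversing involution `σ` on a partial order whose elements are pairwise nested
and none of which lies below its inverse. -/
structure IsTreeSet {α : Type*} [PartialOrder α] (σ : α → α) : Prop where
  invol : ∀ a, σ (σ a) = a
  anti : ∀ a b, a ≤ b → σ b ≤ σ a
  nested : ∀ a b, a ≤ b ∨ b ≤ a ∨ a ≤ σ b ∨ σ b ≤ a
  not_le : ∀ a, ¬a ≤ σ a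

/-- The consistent orientations of a tree set. -/
def TreeNode {α : Type*} [PartialOrder α] (σ : α → α) : Type _ :=
  {O : Set α // (∀ a, a ∈ O ↔ σ a ∉ O) ∧ IsLowerSet O}

namespace IsTreeSet

variable {α : Type*} [PartialOrder α] {σ : α → α}

/-- Two consistent orientations are adjacent if they differ in a single inverse pair. -/
def tree (h : IsTreeSet σ) : SimpleGraph (TreeNode σ) where
  Adj O U := ∃ a, a ∈ O.1 ∧ a ∉ U.1 ∧ ∀ b, b ∈ O.1 → b ∉ U.1 → b = a
  symm := ⟨by
    rintro O U ⟨a, ha, ha', hu⟩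
    refine ⟨σ a, ?_, ?_, ?_⟩
    · rw [U.2.1, h.invol]; exact ha'
    · exact (O.2.1 a).1 ha
    · intro b hb hb'
      rw [← hu (σ b), h.invol]
      · rw [O.2.1, h.invol]; exact hb'
      · exact (U.2.1 b).1 hb⟩
  loopless := ⟨by
    rintro O ⟨a, ha, ha', -⟩
    exact ha' ha⟩

theorem mem_inv (h : IsTreeSet σ) (O : TreeNode σ) {a : α} : σ a ∈ O.1 ↔ a ∉ O.1 := by
  rw [O.2.1, h.invol]

theorem node_ext (h : IsTreeSet σ) {O U : TreeNode σ} (hs : O.1 ⊆ U.1) : O = U := by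
  apply Subtype.ext
  refine hs.antisymm fun a ha => ?_
  by_contra hc
  exact (U.2.1 a).1 ha (hs ((h.mem_inv O).2 hc))

theorem exists_flip (h : IsTreeSet σ) (O : TreeNode σ) {a : α} (ha : a ∈ O.1)
    (hmax : ∀ b ∈ O.1, a ≤ b → b = a) :
    ∃ U : TreeNode σ, h.tree.Adj O U ∧ ∀ b, b ∈ U.1 ↔ b = σ a ∨ (b ∈ O.1 ∧ b ≠ a) := by
  have hne : σ a ≠ a := fun e => (O.2.1 a).1 ha (by rw [e]; exact ha)
  have hinj : ∀ b c, σ b = σ c ↔ b = c := fun b c =>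
    ⟨fun e => by rw [← h.invol b, e, h.invol], fun e => by rw [e]⟩
  refine ⟨⟨{b | b = σ a ∨ (b ∈ O.1 ∧ b ≠ a)}, ?_, ?_⟩, ⟨a, ha, ?_, ?_⟩, fun b => Iff.rfl⟩
  · intro b
    have h1 : σ b = a ↔ b = σ a := by rw [← hinj (σ b), h.invol]
    simp only [Set.mem_ofPred_eq, hinj, h.mem_inv, ne_eq, h1]
    by_cases e : b = a
    · subst e; simp [hne.symm]
    · by_cases e2 : b = σ a <;> simp [e, e2, hne]
  · intro b c hcb hb
    rcases hb with rfl | ⟨hb, hba⟩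
    · by_cases hc : c = σ a
      · exact Or.inl hc
      · refine Or.inr ⟨?_, ?_⟩
        · rw [O.2.1]
          intro hs
          have := hmax _ hs (by simpa [h.invol] using h.anti _ _ hcb)
          exact hc (by rw [← this, h.invol])
        · rintro rfl
          exact h.not_le _ hcb
    · refine Or.inr ⟨O.2.2 hcb hb, ?_⟩
      rintro rfl
      exact hba (hmax _ hb hcb)
  · simp [hne.symm]
  · intro b hb hb'
    by_contra e
    exact hb' (Or.inr ⟨hb, e⟩)

theorem reachable_of_subset [Finite α] (h : IsTreeSet σ) (Q : Set α)
    (H : SimpleGraph (TreeNode σ))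
    (hH : ∀ O U : TreeNode σ, Q ⊆ O.1 → Q ⊆ U.1 → h.tree.Adj O U → H.Adj O U) (U : TreeNode σ)
    (hU : Q ⊆ U.1) (n : ℕ) :
    ∀ O : TreeNode σ, Q ⊆ O.1 → (O.1 \ U.1).ncard = n → H.Reachable O U := by
  induction n with
  | zero =>
    intro O _ hn
    rw [Set.ncard_eq_zero (Set.toFinite _), Set.sdiff_eq_empty] at hn
    rw [h.node_ext hn]
  | succ n ih =>
    intro O hO hn
    have hne : (O.1 \ U.1).Nonempty := by
      rw [← Set.ncard_pos (Set.toFinite _)]; omega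
    obtain ⟨a, ha⟩ := (Set.toFinite (O.1 \ U.1)).exists_maximal hne
    obtain ⟨W, hadj, hW⟩ := h.exists_flip O ha.prop.1 (by
      intro b hb hab
      refine le_antisymm (ha.2 ⟨hb, fun hbU => ha.prop.2 (U.2.2 hab hbU)⟩ hab) hab)
    have hQW : Q ⊆ W.1 := fun q hq =>
      (hW q).2 (Or.inr ⟨hO hq, fun e => ha.prop.2 (e ▸ hU hq)⟩)
    refine (hH O W hO hQW hadj).reachable.trans (ih W hQW ?_)
    have : W.1 \ U.1 = (O.1 \ U.1) \ {a} := by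
      ext b
      simp only [Set.mem_sdiff, hW, Set.mem_singleton_iff]
      constructor
      · rintro ⟨rfl | hb, hb'⟩
        · exact absurd ((h.mem_inv U).2 ha.prop.2) hb'
        · exact ⟨⟨hb.1, hb'⟩, hb.2⟩
      · rintro ⟨⟨hb, hb'⟩, hne⟩
        exact ⟨Or.inr ⟨hb, hne⟩, hb'⟩
    rw [this, Set.ncard_sdiff_singleton_of_mem ha.prop, hn]
    rfl

theorem mem_of_adj (h : IsTreeSet σ) {O U : TreeNode σ} {a : α} (hadj : h.tree.Adj O U)
    (ha : a ∈ O.1) (ha' : a ∉ U.1) {b : α} : b ∈ O.1 ↔ (b ∈ U.1 ∧ b ≠ σ a) ∨ b = a := by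
  obtain ⟨c, hc, hc', hu⟩ := hadj
  obtain rfl : a = c := hu a ha ha'
  constructor
  · intro hb
    by_cases e : b = a
    · exact Or.inr e
    · refine Or.inl ⟨by_contra fun h' => e (hu b hb h'), ?_⟩
      rintro rfl
      exact (O.2.1 a).1 ha hb
  · rintro (⟨hb, hne⟩ | rfl)
    · by_contra hbO
      apply hne
      rw [← hu (σ b) ((h.mem_inv O).2 hbO) ((U.2.1 b).1 hb), h.invol]
    · exact ha

/-- An element of `O` whose inversion yields an adjacent node is maximal in `O`. -/
theorem eq_of_adj_of_le (h : IsTreeSet σ) {O U : TreeNode σ} {a b : α} (hadj : h.tree.Adj O U)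
    (ha : a ∈ O.1) (ha' : a ∉ U.1) (hb : b ∈ O.1) (hab : a ≤ b) : b = a := by
  rcases (h.mem_of_adj hadj ha ha').1 hb with hb | hb
  · exact absurd (U.2.2 hab hb.1) ha'
  · exact hb

theorem node_unique (h : IsTreeSet σ) {O U O' U' : TreeNode σ} {a : α}
    (h1 : h.tree.Adj O U) (ha : a ∈ O.1) (ha' : a ∉ U.1)
    (h2 : h.tree.Adj O' U') (hb : a ∈ O'.1) (hb' : a ∉ U'.1) : O = O' := by
  apply h.node_ext
  intro c hc
  rcases h.nested c a with hca | hac | hca | hac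
  · exact O'.2.2 hca hb
  · rw [h.eq_of_adj_of_le h1 ha ha' hc hac]; exact hb
  · rw [O'.2.1]
    intro hs
    have h3 : a ≤ σ c := by simpa [h.invol] using h.anti _ _ hca
    have h4 := h.eq_of_adj_of_le h2 hb hb' hs h3
    rw [← h4, h.mem_inv] at ha
    exact ha hc
  · have h3 : σ c ≤ a := by simpa [h.invol] using h.anti _ _ hac
    exact absurd (O.2.2 h3 ha) ((O.2.1 c).1 hc)

theorem edge_unique (h : IsTreeSet σ) {O U O' U' : TreeNode σ} {a : α}
    (h1 : h.tree.Adj O U) (ha : a ∈ O.1) (ha' : a ∉ U.1)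
    (h2 : h.tree.Adj O' U') (hb : a ∈ O'.1) (hb' : a ∉ U'.1) : O = O' ∧ U = U' := by
  refine ⟨h.node_unique h1 ha ha' h2 hb hb', ?_⟩
  refine h.node_unique (a := σ a) h1.symm ?_ ?_ h2.symm ?_ ?_
  · exact (h.mem_inv _).2 ha'
  · exact (O.2.1 _).1 ha
  · exact (h.mem_inv _).2 hb'
  · exact (O'.2.1 _).1 hb

theorem side_eq [Finite α] (h : IsTreeSet σ) {O U : TreeNode σ} {a : α} (hadj : h.tree.Adj O U)
    (ha : a ∈ O.1) (ha' : a ∉ U.1) : side h.tree O U = {W | a ∈ W.1} := by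
  ext W
  constructor
  · rintro ⟨w⟩
    by_contra hW
    obtain ⟨d, -, hd, hd'⟩ := w.exists_boundary_dart {W | a ∈ W.1} ha hW
    have hd2 := d.adj
    rw [SimpleGraph.deleteEdges_adj] at hd2
    obtain ⟨e1, e2⟩ := h.edge_unique hadj ha ha' hd2.1 hd hd'
    exact hd2.2 (by rw [← e1, ← e2]; rfl)
  · intro hW
    refine (h.reachable_of_subset {a} _ ?_ O (by simpa using ha) _ W (by simpa using hW)
      rfl).symm
    intro X Y hX hY hXY
    rw [SimpleGraph.deleteEdges_adj]
    refine ⟨hXY, fun he => ?_⟩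
    simp only [Set.singleton_subset_iff] at hX hY
    rw [Set.mem_singleton_iff, Sym2.eq_iff] at he
    rcases he with ⟨rfl, rfl⟩ | ⟨rfl, rfl⟩
    · exact ha' hY
    · exact ha' hX

theorem exists_node_extending [Finite α] (h : IsTreeSet σ) (P : Set α) (hP : IsLowerSet P)
    (hP' : ∀ a ∈ P, σ a ∉ P) : ∃ O : TreeNode σ, P ⊆ O.1 := by
  obtain ⟨O, hPO, hO⟩ := (Set.toFinite {Q : Set α | IsLowerSet Q ∧ ∀ a ∈ Q, σ a ∉ Q}).exists_le_maximal
    (a := P) ⟨hP, hP'⟩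
  refine ⟨⟨O, ?_, hO.prop.1⟩, hPO⟩
  intro a
  refine ⟨hO.prop.2 a, fun ha => ?_⟩
  by_contra ha2
  obtain ⟨b, hb⟩ := (Set.toFinite {b | b ∉ O ∧ σ b ∉ O}).exists_minimal ⟨a, ha2, ha⟩
  have hlow : ∀ c, c < b → c ∈ O := by
    intro c hc
    by_contra hcO
    by_cases hc' : σ c ∈ O
    · exact hb.prop.2 (hO.prop.1 (h.anti _ _ hc.le) hc')
    · exact absurd (hb.2 ⟨hcO, hc'⟩ hc.le) (not_le_of_gt hc)
  refine hb.prop.1 (hO.2 (y := insert b O) ⟨?_, ?_⟩ (Set.subset_insert _ _) (Set.mem_insert _ _))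
  · intro c d hdc hc
    rcases hc with rfl | hc
    · rcases hdc.eq_or_lt with rfl | hlt
      · exact Set.mem_insert _ _
      · exact Or.inr (hlow d hlt)
    · exact Or.inr (hO.prop.1 hdc hc)
  · rintro c (rfl | hc) (hc' | hc')
    · exact h.not_le c hc'.ge
    · exact hb.prop.2 hc'
    · exact hb.prop.2 (by rw [← hc', h.invol]; exact hc)
    · exact hO.prop.2 c hc hc'

theorem isTree [Finite α] (h : IsTreeSet σ) : h.tree.IsTree := by
  refine ⟨@SimpleGraph.Connected.mk _ _ (fun O U => ?_) ?_, ?_⟩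
  · exact h.reachable_of_subset ∅ _ (fun _ _ _ _ h => h) U (Set.empty_subset _) _ O
      (Set.empty_subset _) rfl
  · obtain ⟨O, -⟩ := h.exists_node_extending ∅ (by intro a b _ hb; exact hb) (by simp)
    exact ⟨O⟩
  · rw [SimpleGraph.isAcyclic_iff_forall_adj_isBridge]
    intro O U hadj
    rw [SimpleGraph.isBridge_iff]
    obtain ⟨a, ha, ha', -⟩ := id hadj
    intro hr
    have : U ∈ side h.tree O U := hr
    rw [h.side_eq hadj ha ha'] at this
    exact ha' this

theorem mem_of_mem_path (h : IsTreeSet σ) {O U W : TreeNode σ} (w : h.tree.Walk O U)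
    (hw : w.IsPath) (hW : W ∈ w.support) {a : α} (ha : a ∈ W.1) : a ∈ O.1 ∨ a ∈ U.1 := by
  induction w with
  | nil =>
    simp only [SimpleGraph.Walk.support_nil, List.mem_singleton] at hW
    subst hW; exact Or.inl ha
  | @cons O X U hadj p ih =>
    rw [SimpleGraph.Walk.cons_isPath_iff] at hw
    rw [SimpleGraph.Walk.support_cons, List.mem_cons] at hW
    rcases hW with rfl | hW
    · exact Or.inl ha
    · rcases ih hw.1 hW with hX | hU
      · by_contra! hc
        obtain ⟨d, hd, hd1, hd2⟩ := p.exists_boundary_dart {W | a ∈ W.1} hX hc.2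
        obtain ⟨-, e⟩ := h.edge_unique hadj.symm hX hc.1 d.adj hd1 hd2
        exact hw.2 (e ▸ p.dart_snd_mem_support_of_mem_darts hd)
      · exact Or.inr hU

/-- Every element labels an edge of the tree. -/
theorem exists_adj [Finite α] (h : IsTreeSet σ) (a : α) :
    ∃ O U : TreeNode σ, h.tree.Adj O U ∧ a ∈ O.1 ∧ a ∉ U.1 := by
  have key : ∀ a, ∃ O : TreeNode σ, a ∈ O.1 := by
    intro a
    obtain ⟨O, hO⟩ := h.exists_node_extending (Set.Iic a) (isLowerSet_Iic a) (by
      intro b hb hb'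
      have := h.anti _ _ hb'
      rw [h.invol] at this
      have h2 := h.not_le (σ a)
      rw [h.invol] at h2
      exact h2 (this.trans hb))
    exact ⟨O, hO le_rfl⟩
  obtain ⟨O, hO⟩ := key a
  obtain ⟨U, hU⟩ := key (σ a)
  rw [h.mem_inv] at hU
  obtain ⟨w⟩ := h.isTree.1.preconnected O U
  obtain ⟨d, -, hd, hd'⟩ := w.exists_boundary_dart {W | a ∈ W.1} hO hU
  exact ⟨d.fst, d.snd, d.adj, hd, hd'⟩

/-- The tree automorphism induced by an automorphism of the tree set. -/
def treeIso (h : IsTreeSet σ) (f : α ≃o α) (hf : ∀ a, f (σ a) = σ (f a)) :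
    h.tree ≃g h.tree where
  toFun O := ⟨f.symm ⁻¹' O.1, by
    have hf' : ∀ a, f.symm (σ a) = σ (f.symm a) := fun a => by
      rw [OrderIso.symm_apply_eq, hf, f.apply_symm_apply]
    refine ⟨fun a => ?_, fun a b hba ha => O.2.2 (f.symm.monotone hba) ha⟩
    rw [Set.mem_preimage, Set.mem_preimage, hf']
    exact O.2.1 _⟩
  invFun O := ⟨f ⁻¹' O.1, by
    refine ⟨fun a => ?_, fun a b hba ha => O.2.2 (f.monotone hba) ha⟩
    rw [Set.mem_preimage, Set.mem_preimage, hf]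
    exact O.2.1 _⟩
  left_inv O := by apply Subtype.ext; ext a; simp
  right_inv O := by apply Subtype.ext; ext a; simp
  map_rel_iff' := by
    intro O U
    constructor
    · rintro ⟨a, ha, ha', hu⟩
      refine ⟨f.symm a, ha, ha', fun b hb hb' => ?_⟩
      have hb1 : f.symm (f b) ∈ O.1 := by rwa [f.symm_apply_apply]
      have hb2 : f.symm (f b) ∉ U.1 := by rwa [f.symm_apply_apply]
      rw [← hu (f b) hb1 hb2, f.symm_apply_apply]
    · rintro ⟨a, ha, ha', hu⟩
      have ha1 : f.symm (f a) ∈ O.1 := by rwa [f.symm_apply_apply]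
      have ha2 : f.symm (f a) ∉ U.1 := by rwa [f.symm_apply_apply]
      refine ⟨f a, ha1, ha2, fun b hb hb' => ?_⟩
      rw [← hu (f.symm b) hb hb', f.apply_symm_apply]

theorem mem_treeIso (h : IsTreeSet σ) (f : α ≃o α) (hf : ∀ a, f (σ a) = σ (f a))
    (O : TreeNode σ) (a : α) : a ∈ (h.treeIso f hf O).1 ↔ f.symm a ∈ O.1 := Iff.rfl

end IsTreeSet

section TreeDecomp

variable {α : Type*} [PartialOrder α] {σ : α → α} {s : α → Set V × Set V}

/-- The part of the tree-decomposition at the node `O`. -/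
def nodePart (s : α → Set V × Set V) (O : TreeNode σ) : Set V :=
  {v | ∀ a ∈ O.1, v ∈ (s a).2}

theorem exists_subset_nodePart [Finite α] (h : IsTreeSet σ)
    (hle : ∀ a b, a ≤ b ↔ SepLE (s a) (s b)) (hσ : ∀ a, s (σ a) = (s a).swap) (X : Set V)
    (hX : ∀ a, X ⊆ (s a).1 ∨ X ⊆ (s a).2) :
    ∃ O : TreeNode σ, X ⊆ nodePart s O ∧ ∀ a, ¬X ⊆ (s a).1 → a ∈ O.1 := by
  obtain ⟨O, hO⟩ := h.exists_node_extending {a | ¬X ⊆ (s a).1}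
    (fun a b hba ha hb => ha (hb.trans ((hle _ _).1 hba).1)) (by
      intro a ha hb
      simp only [Set.mem_ofPred_eq, hσ, Prod.fst_swap] at ha hb
      exact (hX a).elim ha hb)
  refine ⟨O, fun v hv a ha => ?_, fun a ha => hO ha⟩
  by_contra hva
  have : σ a ∈ O.1 := hO (by
    simp only [Set.mem_ofPred_eq, hσ, Prod.fst_swap]
    exact fun hs => hva (hs hv))
  exact (O.2.1 a).1 ha this

theorem IsSep.mem_or {G : SimpleGraph V} {p : Set V × Set V} (hp : IsSep G p) (v : V) :
    v ∈ p.1 ∨ v ∈ p.2 := by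
  have : v ∈ p.1 ∪ p.2 := by rw [hp.1]; trivial
  exact this

theorem isTreeDecomp_nodePart [Finite α] (G : SimpleGraph V) (h : IsTreeSet σ)
    (hle : ∀ a b, a ≤ b ↔ SepLE (s a) (s b)) (hσ : ∀ a, s (σ a) = (s a).swap)
    (hsep : ∀ a, IsSep G (s a)) : IsTreeDecomp G h.tree (nodePart s) := by
  refine ⟨h.isTree, ?_, ?_, ?_⟩
  · rw [Set.eq_univ_iff_forall]
    intro v
    obtain ⟨O, hO, -⟩ := exists_subset_nodePart h hle hσ {v} (fun a => by
      simpa using (hsep a).mem_or v)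
    exact Set.mem_iUnion.2 ⟨O, hO rfl⟩
  · intro u v huv
    obtain ⟨O, hO, -⟩ := exists_subset_nodePart h hle hσ {u, v} (fun a => by
      simp only [Set.insert_subset_iff, Set.singleton_subset_iff]
      have hu := (hsep a).mem_or u
      have hv := (hsep a).mem_or v
      by_contra! hc
      by_cases h1 : u ∈ (s a).1
      · have h2 := hc.1 h1
        have h3 := hv.resolve_left h2
        exact (hsep a).2 u ⟨h1, fun h4 => hc.2 h4 h3⟩ v ⟨h3, h2⟩ huv
      · have h2 := hu.resolve_left h1
        have h3 := hc.2 h2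
        exact (hsep a).2 v ⟨hv.resolve_right h3, h3⟩ u ⟨h2, h1⟩ huv.symm)
    exact ⟨O, hO (by simp), hO (by simp)⟩
  · intro O U w hw W hW v hv a ha
    exact (h.mem_of_mem_path w hw hW ha).elim (hv.1 a) (hv.2 a)

theorem iUnion_nodePart [Finite α] {G : SimpleGraph V} (h : IsTreeSet σ)
    (hle : ∀ a b, a ≤ b ↔ SepLE (s a) (s b)) (hσ : ∀ a, s (σ a) = (s a).swap)
    (hsep : ∀ a, IsSep G (s a)) (a : α) :
    ⋃ O ∈ {O : TreeNode σ | a ∈ O.1}, nodePart s O = (s a).2 := by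
  ext v
  simp only [Set.mem_iUnion, Set.mem_ofPred_eq, exists_prop]
  constructor
  · rintro ⟨O, ha, hv⟩
    exact hv a ha
  · intro hv
    have hinv : ∀ a, σ (σ a) = a := h.invol
    have h2 : ∀ c, ¬σ c ≤ c := fun c hc => h.not_le (σ c) (by rwa [hinv])
    obtain ⟨O, hO⟩ := h.exists_node_extending ({b | v ∉ (s b).1} ∪ Set.Iic a) (by
        apply IsLowerSet.union
        · exact fun b c hcb hb hc => hb (((hle _ _).1 hcb).1 hc)
        · exact isLowerSet_Iic a) (by
        have key : ∀ b, b ≤ a → v ∈ (s b).2 := fun b hb => ((hle _ _).1 hb).2 hv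
        rintro b (hb | hb) (hb' | hb')
        · simp only [Set.mem_ofPred_eq, hσ, Prod.fst_swap] at hb hb'
          exact ((hsep b).mem_or v).elim hb hb'
        · have := key _ hb'
          rw [hσ] at this
          exact hb this
        · simp only [Set.mem_ofPred_eq, hσ, Prod.fst_swap] at hb'
          exact hb' (key _ hb)
        · have := h.anti _ _ hb'
          rw [hinv] at this
          exact h2 a (this.trans hb))
    refine ⟨O, hO (Or.inr le_rfl), fun b hb => ?_⟩
    by_contra hvb
    have : σ b ∈ O.1 := hO (Or.inl (by
      simp only [Set.mem_ofPred_eq, hσ, Prod.fst_swap]; exact hvb))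
    exact (O.2.1 b).1 hb this

theorem inducedSep_nodePart [Finite α] {G : SimpleGraph V} (h : IsTreeSet σ)
    (hle : ∀ a b, a ≤ b ↔ SepLE (s a) (s b)) (hσ : ∀ a, s (σ a) = (s a).swap)
    (hsep : ∀ a, IsSep G (s a)) {O U : TreeNode σ} {a : α} (hadj : h.tree.Adj O U)
    (ha : a ∈ O.1) (ha' : a ∉ U.1) :
    inducedSep h.tree (nodePart s) O U = (s a).swap := by
  have h2 := h.side_eq hadj.symm ((h.mem_inv U).2 ha') ((O.2.1 a).1 ha)
  unfold inducedSep
  rw [h.side_eq hadj ha ha', h2, iUnion_nodePart h hle hσ hsep, iUnion_nodePart h hle hσ hsep, hσ]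
  rfl

end TreeDecomp

/-- The image of a pair of vertex sets under an automorphism. -/
def mapSep {G : SimpleGraph V} (φ : G ≃g G) (p : Set V × Set V) : Set V × Set V :=
  (φ '' p.1, φ '' p.2)

@[simp] theorem mapSep_symm {G : SimpleGraph V} (φ : G ≃g G) (p : Set V × Set V) :
    mapSep φ.symm (mapSep φ p) = p := by
  apply Prod.ext <;> simp [mapSep, Set.image_image]

@[simp] theorem mapSep_symm' {G : SimpleGraph V} (φ : G ≃g G) (p : Set V × Set V) :
    mapSep φ (mapSep φ.symm p) = p := by
  apply Prod.ext <;> simp [mapSep, Set.image_image]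

theorem sepLE_mapSep {G : SimpleGraph V} (φ : G ≃g G) {p q : Set V × Set V} :
    SepLE (mapSep φ p) (mapSep φ q) ↔ SepLE p q := by
  simp [SepLE, mapSep, Set.image_subset_image_iff φ.injective]

theorem mapSep_swap {G : SimpleGraph V} (φ : G ≃g G) (p : Set V × Set V) :
    mapSep φ p.swap = (mapSep φ p).swap := rfl

/-- A nested, automorphism-invariant system of proper separations is induced by a canonical
tree-decomposition. -/
theorem exists_treeDecomp_of_nestedSystem [Finite V] (G : SimpleGraph V)
    (N : Set (Set V × Set V)) (hsys : IsSepSystem G N) (hnest : NestedSystem N)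
    (hprop : ProperSystem N) (hinv : ∀ φ : G ≃g G, ∀ p ∈ N, mapSep φ p ∈ N) :
    ∃ (ι : Type) (_ : Fintype ι) (T : SimpleGraph ι) (Vt : ι → Set V),
      IsTreeDecomp G T Vt ∧ Canonical G T Vt ∧
      (∀ t u, T.Adj t u → ∃ p ∈ N, Vt t ∩ Vt u ⊆ p.1 ∩ p.2) ∧ N ⊆ inducedSeps T Vt ∧
      ∀ X : Set V, (∀ p ∈ N, X ⊆ p.1 ∨ X ⊆ p.2) →
        ∃ t, X ⊆ Vt t ∧ ∀ p ∈ N, ¬X ⊆ p.1 → Vt t ⊆ p.2 := by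
  obtain ⟨A, ⟨e⟩⟩ : ∃ A : Type, Nonempty (A ≃ N) := by
    obtain ⟨n, ⟨e⟩⟩ := Finite.exists_equiv_fin N
    exact ⟨Fin n, ⟨e.symm⟩⟩
  have : Finite A := Finite.of_equiv _ e.symm
  let s : A → Set V × Set V := fun a => (e a).1
  have hsN : ∀ a, s a ∈ N := fun a => (e a).2
  have hs_inj : Function.Injective s := Subtype.val_injective.comp e.injective
  have hs_surj : ∀ p ∈ N, ∃ a, s a = p := fun p hp =>
    ⟨e.symm ⟨p, hp⟩, by simp [s]⟩
  let _ : PartialOrder (A) :=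
    { le := fun a b => SepLE (s a) (s b)
      le_refl := fun a => ⟨subset_rfl, subset_rfl⟩
      le_trans := fun a b c h1 h2 => ⟨h1.1.trans h2.1, h2.2.trans h1.2⟩
      le_antisymm := fun a b h1 h2 =>
        hs_inj (Prod.ext (h1.1.antisymm h2.1) (h2.2.antisymm h1.2)) }
  have hle : ∀ a b : A, a ≤ b ↔ SepLE (s a) (s b) := fun a b => Iff.rfl
  let σ : A → A := fun a => e.symm ⟨(s a).swap, hsys.2 _ (hsN a)⟩
  have hσ : ∀ a, s (σ a) = (s a).swap := fun a => by simp [s, σ]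
  have hsep : ∀ a, IsSep G (s a) := fun a => hsys.1 _ (hsN a)
  have h : IsTreeSet σ :=
    { invol := fun a => hs_inj (by rw [hσ, hσ, Prod.swap_swap])
      anti := fun a b hab => by
        rw [hle, hσ, hσ]; exact ⟨hab.2, hab.1⟩
      nested := fun a b => by
        rw [hle, hle, hle, hle, hσ]; exact hnest _ (hsN a) _ (hsN b)
      not_le := fun a hab => by
        rw [hle, hσ] at hab
        obtain ⟨v, hv, hv'⟩ := (hprop _ (hsN a)).1
        exact hv' (hab.1 hv) }
  have : Finite (TreeNode σ) := Subtype.finite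
  let f : (G ≃g G) → (A ≃o A) := fun φ =>
    { toFun := fun a => e.symm ⟨mapSep φ (s a), hinv φ _ (hsN a)⟩
      invFun := fun a => e.symm ⟨mapSep φ.symm (s a), hinv φ.symm _ (hsN a)⟩
      left_inv := fun a => hs_inj (by simp [s])
      right_inv := fun a => hs_inj (by simp [s])
      map_rel_iff' := by
        intro a b
        simp only [hle, s, Equiv.coe_fn_mk, Equiv.apply_symm_apply]
        exact sepLE_mapSep φ }
  have hf_symm : ∀ φ a, s ((f φ).symm a) = mapSep φ.symm (s a) := fun φ a => by
    change s (e.symm ⟨mapSep φ.symm (s a), _⟩) = _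
    simp [s]
  have hfσ : ∀ φ a, f φ (σ a) = σ (f φ a) := fun φ a => hs_inj (by
    have hf : ∀ a, s (f φ a) = mapSep φ (s a) := fun a => by
      change s (e.symm ⟨mapSep φ (s a), _⟩) = _
      simp [s]
    rw [hf, hσ, hσ, hf, mapSep_swap])
  refine ⟨TreeNode σ, Fintype.ofFinite _, h.tree, nodePart s,
    isTreeDecomp_nodePart G h hle hσ hsep, ⟨fun φ => h.treeIso (f φ) (hfσ φ), ?_, ?_⟩, ?_, ?_, ?_⟩
  · intro φ ψ
    apply RelIso.ext
    intro O
    apply Subtype.ext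
    ext a
    change a ∈ (h.treeIso _ (hfσ _) O).1 ↔
      a ∈ (h.treeIso _ (hfσ ψ) (h.treeIso _ (hfσ φ) O)).1
    rw [h.mem_treeIso, h.mem_treeIso, h.mem_treeIso]
    have : (f (φ.trans ψ)).symm a = (f φ).symm ((f ψ).symm a) := hs_inj (by
      rw [hf_symm, hf_symm, hf_symm]
      apply Prod.ext <;> simp only [mapSep, Set.image_image] <;> rfl)
    rw [this]
  · intro φ O
    ext v
    have hv : v ∈ φ '' nodePart s O ↔ φ.symm v ∈ nodePart s O := by
      constructor
      · rintro ⟨u, hu, rfl⟩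
        simpa using hu
      · intro hu
        exact ⟨_, hu, by simp⟩
    rw [hv]
    constructor
    · intro hu a ha
      have := hu _ ((h.mem_treeIso _ _ _ _).1 ha)
      rw [hf_symm] at this
      obtain ⟨w, hw, hw'⟩ := this
      rw [← φ.symm.injective hw']
      exact hw
    · intro hu a ha
      have := hu (f φ a) ((h.mem_treeIso _ (hfσ φ) _ _).2 (by simpa using ha))
      rw [← (f φ).symm_apply_apply a, hf_symm]
      exact ⟨_, this, rfl⟩
  · intro O U hadj
    obtain ⟨a, ha, ha', -⟩ := id hadj
    refine ⟨s a, hsN a, fun v hv => ⟨?_, hv.1 a ha⟩⟩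
    have := hv.2 _ ((h.mem_inv U).2 ha')
    rwa [hσ] at this
  · intro p hp
    obtain ⟨a, ha⟩ := hs_surj _ (hsys.2 p hp)
    obtain ⟨O, U, hadj, haO, haU⟩ := h.exists_adj a
    refine ⟨O, U, hadj, ?_⟩
    rw [inducedSep_nodePart h hle hσ hsep hadj haO haU, ha, Prod.swap_swap]
  · intro X hX
    obtain ⟨O, hO, hO'⟩ := exists_subset_nodePart h hle hσ X (fun a => hX _ (hsN a))
    refine ⟨O, hO, fun p hp hXp v hv => ?_⟩
    obtain ⟨a, rfl⟩ := hs_surj p hp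
    exact hv a (hO' a hXp)

/-- The corner `(A ∩ C, B ∪ D)` of `(A, B)` and `(C, D)`. -/
def corner (p q : Set V × Set V) : Set V × Set V := (p.1 ∩ q.1, p.2 ∪ q.2)

theorem Nested.symm {p q : Set V × Set V} (h : Nested p q) : Nested q p := by
  rcases h with h | h | h | h
  · exact Or.inr (Or.inl h)
  · exact Or.inl h
  · exact Or.inr (Or.inr (Or.inl ⟨h.2, h.1⟩))
  · exact Or.inr (Or.inr (Or.inr ⟨h.2, h.1⟩))

theorem nested_comm {p q : Set V × Set V} : Nested p q ↔ Nested q p := ⟨.symm, .symm⟩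

@[simp] theorem nested_swap_right {p q : Set V × Set V} : Nested p q.swap ↔ Nested p q := by
  simp only [Nested, Prod.swap_swap]
  tauto

@[simp] theorem nested_swap_left {p q : Set V × Set V} : Nested p.swap q ↔ Nested p q := by
  rw [nested_comm, nested_swap_right, nested_comm]

theorem nested_corner_left (p q : Set V × Set V) : Nested p (corner p q) :=
  Or.inr (Or.inl ⟨Set.inter_subset_left, Set.subset_union_left⟩)

theorem nested_corner_of_nested {r p q : Set V × Set V} (hp : Nested r p) (hq : Nested r q)
    (hpq : ¬Nested p q) : Nested r (corner p q) := by
  have trans : ∀ {a b c : Set V × Set V}, SepLE a b → SepLE b c → SepLE a c :=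
    fun h1 h2 => ⟨h1.1.trans h2.1, h2.2.trans h1.2⟩
  have inv : ∀ {a b : Set V × Set V}, SepLE a b → SepLE b.swap a.swap := fun h => ⟨h.2, h.1⟩
  have cp : SepLE (corner p q) p := ⟨Set.inter_subset_left, Set.subset_union_left⟩
  have cq : SepLE (corner p q) q := ⟨Set.inter_subset_right, Set.subset_union_right⟩
  have glb : ∀ {a}, SepLE a p → SepLE a q → SepLE a (corner p q) := fun h1 h2 =>
    ⟨Set.subset_inter h1.1 h2.1, Set.union_subset h1.2 h2.2⟩
  rcases hp with hp | hp | hp | hp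
  · rcases hq with hq | hq | hq | hq
    · exact Or.inl (glb hp hq)
    · exact Or.inr (Or.inl (trans cq hq))
    · exact Or.inr (Or.inr (Or.inl (trans hq (inv cq))))
    · exact absurd (Or.inr (Or.inr (Or.inr (trans hq hp)))) hpq
  · exact Or.inr (Or.inl (trans cp hp))
  · exact Or.inr (Or.inr (Or.inl (trans hp (inv cp))))
  · rcases hq with hq | hq | hq | hq
    · exact absurd (Or.inr (Or.inr (Or.inr (inv (trans hp hq))))) hpq
    · exact Or.inr (Or.inl (trans cq hq))
    · exact Or.inr (Or.inr (Or.inl (trans hq (inv cq))))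
    · exact Or.inr (Or.inr (Or.inr (inv (glb (inv hp) (inv hq)))))

theorem nested_corner_or_of_nested {r p : Set V × Set V} (q : Set V × Set V) (hp : Nested r p) :
    Nested r (corner p q) ∨ Nested r (corner p.swap q.swap) := by
  have trans : ∀ {a b c : Set V × Set V}, SepLE a b → SepLE b c → SepLE a c :=
    fun h1 h2 => ⟨h1.1.trans h2.1, h2.2.trans h1.2⟩
  have inv : ∀ {a b : Set V × Set V}, SepLE a b → SepLE b.swap a.swap := fun h => ⟨h.2, h.1⟩
  have cp : SepLE (corner p q) p := ⟨Set.inter_subset_left, Set.subset_union_left⟩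
  have cp' : SepLE (corner p.swap q.swap) p.swap := ⟨Set.inter_subset_left, Set.subset_union_left⟩
  rcases hp with hp | hp | hp | hp
  · exact Or.inr (Or.inr (Or.inr (Or.inl (trans hp (inv cp')))))
  · exact Or.inl (Or.inr (Or.inl (trans cp hp)))
  · exact Or.inl (Or.inr (Or.inr (Or.inl (trans hp (inv cp)))))
  · exact Or.inr (Or.inr (Or.inl (trans cp' hp)))

theorem corner_comm (p q : Set V × Set V) : corner p q = corner q p := by
  simp only [corner, Set.inter_comm, Set.union_comm]

/-- The number of pairs of vertex sets crossing `p`. -/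
noncomputable def crossingNumber (p : Set V × Set V) : ℕ := {r | ¬Nested r p}.ncard

theorem crossingNumber_swap (p : Set V × Set V) : crossingNumber p.swap = crossingNumber p := by
  simp [crossingNumber]

theorem crossingNumber_corner_lt [Finite V] {p q : Set V × Set V} (hpq : ¬Nested p q) :
    crossingNumber (corner p q) + crossingNumber (corner p.swap q.swap) <
      crossingNumber p + crossingNumber q := by
  unfold crossingNumber
  rw [← Set.ncard_union_add_ncard_inter _ _ (Set.toFinite _) (Set.toFinite _),
    ← Set.ncard_union_add_ncard_inter {r | ¬Nested r p} _ (Set.toFinite _) (Set.toFinite _)]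
  refine Nat.add_lt_add_of_lt_of_le (Set.ncard_lt_ncard ⟨?_, ?_⟩ (Set.toFinite _))
    (Set.ncard_le_ncard ?_ (Set.toFinite _))
  · rintro r (hr | hr)
    · by_contra hc
      simp only [Set.mem_union, Set.mem_ofPred_eq, not_or, not_not] at hc
      exact hr (nested_corner_of_nested hc.1 hc.2 hpq)
    · by_contra hc
      simp only [Set.mem_union, Set.mem_ofPred_eq, not_or, not_not] at hc
      exact hr (nested_corner_of_nested (by simpa using hc.1) (by simpa using hc.2)
        (by simpa using hpq))
  · intro hs
    rcases hs (show p ∈ _ from Or.inr hpq) with h | h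
    · exact h (nested_corner_left p q)
    · have := nested_corner_left p.swap q.swap
      exact h (by simpa using this)
  · rintro r ⟨h1, h2⟩
    refine ⟨fun hc => ?_, fun hc => ?_⟩
    · exact (nested_corner_or_of_nested q hc).elim h1 h2
    · refine (nested_corner_or_of_nested p hc).elim (fun h => h1 ?_) (fun h => h2 ?_)
      · rwa [corner_comm]
      · rwa [corner_comm]

/-- The elements of `C` crossing as few pairs of vertex sets as possible. -/
def crossMin (C : Set (Set V × Set V)) : Set (Set V × Set V) :=
  {p | p ∈ C ∧ ∀ q ∈ C, crossingNumber p ≤ crossingNumber q}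

theorem crossMin_nonempty {C : Set (Set V × Set V)} (hC : C.Nonempty) : (crossMin C).Nonempty := by
  obtain ⟨p, hp, hmin⟩ := exists_minimalFor_of_wellFoundedLT (· ∈ C) crossingNumber hC
  exact ⟨p, hp, fun q hq => (le_total _ _).elim id (hmin hq)⟩

theorem swap_mem_crossMin {C : Set (Set V × Set V)} (hC : ∀ p ∈ C, p.swap ∈ C)
    {p : Set V × Set V} (hp : p ∈ crossMin C) : p.swap ∈ crossMin C :=
  ⟨hC p hp.1, fun q hq => by rw [crossingNumber_swap]; exact hp.2 q hq⟩

/-- Two opposite corners of `p` and `q` lie in `C` and `D`. -/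
def OppositeCorners (C D : Set (Set V × Set V)) (p q : Set V × Set V) : Prop :=
  ∃ p₀ q₀, (p₀ = p ∨ p₀ = p.swap) ∧ (q₀ = q ∨ q₀ = q.swap) ∧
    corner p₀ q₀ ∈ C ∧ corner p₀.swap q₀.swap ∈ D

/-- One pair of opposite corners of `p` and `q` lies in `C`, and the other pair in `D`. -/
def AllCorners (C D : Set (Set V × Set V)) (p q : Set V × Set V) : Prop :=
  ∃ q₀, (q₀ = q ∨ q₀ = q.swap) ∧ corner p q₀ ∈ C ∧ corner p.swap q₀.swap ∈ C ∧
    corner p q₀.swap ∈ D ∧ corner p.swap q₀ ∈ D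

/-- If crossing elements of `C` and `D` can be replaced by opposite corners, then elements of
minimal crossing number are nested. -/
theorem nested_of_mem_crossMin [Finite V] {C D : Set (Set V × Set V)} {p q : Set V × Set V}
    (hp : p ∈ crossMin C) (hq : q ∈ crossMin D)
    (h : ¬Nested p q → OppositeCorners C D p q ∨ AllCorners C D p q) : Nested p q := by
  by_contra hc
  have key : ∀ p₀ q₀, (p₀ = p ∨ p₀ = p.swap) → (q₀ = q ∨ q₀ = q.swap) →
      crossingNumber (corner p₀ q₀) + crossingNumber (corner p₀.swap q₀.swap) <
        crossingNumber p + crossingNumber q := by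
    rintro p₀ q₀ (rfl | rfl) (rfl | rfl)
    · exact crossingNumber_corner_lt hc
    · simpa [crossingNumber_swap] using
        crossingNumber_corner_lt (p := p₀) (q := q.swap) (by simpa using hc)
    · simpa [crossingNumber_swap] using
        crossingNumber_corner_lt (p := p.swap) (q := q₀) (by simpa using hc)
    · simpa [crossingNumber_swap] using
        crossingNumber_corner_lt (p := p.swap) (q := q.swap) (by simpa using hc)
  rcases h hc with ⟨p₀, q₀, h1, h2, h3, h4⟩ | ⟨q₀, h1, h2, h3, h4, h5⟩
  · have := key p₀ q₀ h1 h2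
    have := hp.2 _ h3
    have := hq.2 _ h4
    omega
  · have e1 := key p q₀ (Or.inl rfl) h1
    have e2 := key p q₀.swap (Or.inl rfl) (by rcases h1 with rfl | rfl <;> simp)
    rw [Prod.swap_swap] at e2
    have := hp.2 _ h2
    have := hp.2 _ h3
    have := hq.2 _ h4
    have := hq.2 _ h5
    omega

theorem IsSep.swap {G : SimpleGraph V} {p : Set V × Set V} (hp : IsSep G p) : IsSep G p.swap :=
  ⟨by rw [Prod.fst_swap, Prod.snd_swap, Set.union_comm]; exact hp.1,
    fun a ha b hb hab => hp.2 b hb a ha hab.symm⟩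

theorem IsSep.corner {G : SimpleGraph V} {p q : Set V × Set V} (hp : IsSep G p)
    (hq : IsSep G q) : IsSep G (corner p q) := by
  constructor
  · rw [Set.eq_univ_iff_forall]
    intro v
    have := hp.mem_or v
    have := hq.mem_or v
    simp only [CanonicalTD.corner, Set.mem_union, Set.mem_inter_iff]
    tauto
  · rintro a ⟨⟨ha1, ha2⟩, ha3⟩ b ⟨hb, hb'⟩ hab
    simp only [CanonicalTD.corner, Set.mem_union, not_or, Set.mem_inter_iff] at ha3 hb hb'
    by_cases h1 : b ∈ p.1
    · have h2 : b ∉ q.1 := fun h => hb' ⟨h1, h⟩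
      exact hq.2 a ⟨ha2, ha3.2⟩ b ⟨(hq.mem_or b).resolve_left h2, h2⟩ hab
    · exact hp.2 a ⟨ha1, ha3.1⟩ b ⟨(hp.mem_or b).resolve_left h1, h1⟩ hab

theorem sepOrder_swap (p : Set V × Set V) : sepOrder p.swap = sepOrder p := by
  simp [sepOrder, Set.inter_comm]

theorem sepOrder_corner_add_le [Finite V] (p q : Set V × Set V) :
    sepOrder (corner p q) + sepOrder (corner p.swap q.swap) ≤ sepOrder p + sepOrder q := by
  unfold sepOrder
  rw [← Set.ncard_union_add_ncard_inter _ _ (Set.toFinite _) (Set.toFinite _),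
    ← Set.ncard_union_add_ncard_inter (p.1 ∩ p.2) _ (Set.toFinite _) (Set.toFinite _)]
  refine Nat.add_le_add (Set.ncard_le_ncard ?_ (Set.toFinite _))
    (Set.ncard_le_ncard ?_ (Set.toFinite _))
  · intro x
    simp only [corner, Set.mem_union, Set.mem_inter_iff, Prod.fst_swap, Prod.snd_swap]
    tauto
  · intro x
    simp only [corner, Set.mem_union, Set.mem_inter_iff, Prod.fst_swap, Prod.snd_swap]
    tauto

/-- `p` separates `X` from `Y` with minimum order. -/
structure Efficient (G : SimpleGraph V) (X Y : Set V) (p : Set V × Set V) : Prop where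
  isSep : IsSep G p
  left : X ⊆ p.1
  right : Y ⊆ p.2
  le : ∀ q : Set V × Set V, IsSep G q → X ⊆ q.1 → Y ⊆ q.2 → sepOrder p ≤ sepOrder q

namespace Efficient

variable {G : SimpleGraph V} {X Y Z W : Set V} {p q : Set V × Set V}

theorem swap (h : Efficient G X Y p) : Efficient G Y X p.swap :=
  ⟨h.isSep.swap, h.right, h.left, fun q hq h1 h2 => by
    rw [sepOrder_swap, ← sepOrder_swap q]; exact h.le _ hq.swap h2 h1⟩

theorem of_le (h : Efficient G X Y p) (hq : IsSep G q) (h1 : X ⊆ q.1) (h2 : Y ⊆ q.2)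
    (hle : sepOrder q ≤ sepOrder p) : Efficient G X Y q :=
  ⟨hq, h1, h2, fun r hr h3 h4 => hle.trans (h.le r hr h3 h4)⟩

theorem corner [Finite V] (hp : Efficient G X Y p) (hq : Efficient G Z W q) (hX : X ⊆ q.1)
    (hW : W ⊆ p.2) :
    Efficient G X Y (corner p q) ∧ Efficient G W Z (CanonicalTD.corner p.swap q.swap) := by
  have s1 := hp.isSep.corner hq.isSep
  have s2 := hp.isSep.swap.corner hq.isSep.swap
  have x1 : X ⊆ (CanonicalTD.corner p q).1 := Set.subset_inter hp.left hX
  have y1 : Y ⊆ (CanonicalTD.corner p q).2 := hp.right.trans Set.subset_union_left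
  have w1 : W ⊆ (CanonicalTD.corner p.swap q.swap).1 := Set.subset_inter hW hq.right
  have z1 : Z ⊆ (CanonicalTD.corner p.swap q.swap).2 := hq.left.trans Set.subset_union_right
  have h1 := hp.le _ s1 x1 y1
  have h2 := hq.swap.le _ s2 w1 z1
  have h3 := sepOrder_corner_add_le p q
  rw [sepOrder_swap] at h2
  exact ⟨hp.of_le s1 x1 y1 (by omega), hq.swap.of_le s2 w1 z1 (by rw [sepOrder_swap]; omega)⟩

/-- Crossing efficient separations can be uncrossed by opposite corners. -/
theorem exists_corners [Finite V] (hp : Efficient G X Y p) (hq : Efficient G Z W q)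
    (hX : X ⊆ q.1 ∨ X ⊆ q.2) (hY : Y ⊆ q.1 ∨ Y ⊆ q.2) (hZ : Z ⊆ p.1 ∨ Z ⊆ p.2)
    (hW : W ⊆ p.1 ∨ W ⊆ p.2) {C D : Set (Set V × Set V)}
    (hC : ∀ p₀ q₀, (p₀ = p ∨ p₀ = p.swap) → (q₀ = q ∨ q₀ = q.swap) →
      (Efficient G X Y (CanonicalTD.corner p₀ q₀) ∨
        Efficient G Y X (CanonicalTD.corner p₀ q₀)) → CanonicalTD.corner p₀ q₀ ∈ C)
    (hD : ∀ p₀ q₀, (p₀ = p ∨ p₀ = p.swap) → (q₀ = q ∨ q₀ = q.swap) →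
      (Efficient G Z W (CanonicalTD.corner p₀ q₀) ∨
        Efficient G W Z (CanonicalTD.corner p₀ q₀)) → CanonicalTD.corner p₀ q₀ ∈ D) :
    OppositeCorners C D p q ∨ AllCorners C D p q := by
  have p1 : p = p ∨ p = p.swap := Or.inl rfl
  have p2 : p.swap = p ∨ p.swap = p.swap := Or.inr rfl
  have q1 : q = q ∨ q = q.swap := Or.inl rfl
  have q2 : q.swap = q ∨ q.swap = q.swap := Or.inr rfl
  have a1 (h1 : X ⊆ q.1) (h2 : W ⊆ p.2) : OppositeCorners C D p q :=
    ⟨p, q, p1, q1, hC p q p1 q1 (Or.inl (hp.corner hq h1 h2).1),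
      hD p.swap q.swap p2 q2 (Or.inr (hp.corner hq h1 h2).2)⟩
  have a2 (h1 : Y ⊆ q.1) (h2 : W ⊆ p.1) : OppositeCorners C D p q :=
    ⟨p.swap, q, p2, q1, hC p.swap q p2 q1 (Or.inr (hp.swap.corner hq h1 h2).1),
      hD p q.swap p1 q2 (Or.inr (hp.swap.corner hq h1 h2).2)⟩
  have a3 (h1 : X ⊆ q.2) (h2 : Z ⊆ p.2) : OppositeCorners C D p q :=
    ⟨p, q.swap, p1, q2, hC p q.swap p1 q2 (Or.inl (hp.corner hq.swap h1 h2).1),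
      hD p.swap q p2 q1 (Or.inl (hp.corner hq.swap h1 h2).2)⟩
  have a4 (h1 : Y ⊆ q.2) (h2 : Z ⊆ p.1) : OppositeCorners C D p q :=
    ⟨p.swap, q.swap, p2, q2, hC p.swap q.swap p2 q2 (Or.inr (hp.swap.corner hq.swap h1 h2).1),
      hD p q p1 q1 (Or.inl (hp.swap.corner hq.swap h1 h2).2)⟩
  have b1 (h1 : X ⊆ q.1) (h2 : Y ⊆ q.2) (h3 : Z ⊆ p.2) (h4 : W ⊆ p.1) :
      AllCorners C D p q := by
    have e1 := hp.le q hq.isSep h1 h2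
    have e2 := hq.swap.le p hp.isSep h4 h3
    rw [sepOrder_swap] at e2
    have hq' : Efficient G X Y q := hp.of_le hq.isSep h1 h2 e2
    have hp' : Efficient G W Z p := hq.swap.of_le hp.isSep h4 h3 (by rwa [sepOrder_swap])
    have c1 := hp.corner hq' h1 hp.right
    have c2 := hp'.corner hq.swap hq.right h3
    exact ⟨q, q1, hC p q p1 q1 (Or.inl c1.1), hC p.swap q.swap p2 q2 (Or.inr c1.2),
      hD p q.swap p1 q2 (Or.inr c2.1), hD p.swap q p2 q1 (Or.inl c2.2)⟩
  have b2 (h1 : X ⊆ q.2) (h2 : Y ⊆ q.1) (h3 : Z ⊆ p.1) (h4 : W ⊆ p.2) :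
      AllCorners C D p q := by
    have e1 := hp.le q.swap hq.isSep.swap h1 h2
    have e2 := hq.le p hp.isSep h3 h4
    have e3 := sepOrder_swap q
    have hq' : Efficient G X Y q.swap := hp.of_le hq.isSep.swap h1 h2 (by omega)
    have hp' : Efficient G Z W p := hq.of_le hp.isSep h3 h4 (by omega)
    have c1 := hp.corner hq' h1 hp.right
    have c2 := hp'.corner hq hq.left h4
    exact ⟨q.swap, q2, hC p q.swap p1 q2 (Or.inl c1.1), hC p.swap q p2 q1 (Or.inr c1.2),
      hD p q p1 q1 (Or.inl c2.1), hD p.swap q.swap p2 q2 (Or.inr c2.2)⟩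
  rcases hX with hX | hX <;> rcases hY with hY | hY <;> rcases hZ with hZ | hZ <;>
    rcases hW with hW | hW <;> first
      | exact Or.inl (a1 hX hW) | exact Or.inl (a2 hY hW) | exact Or.inl (a3 hX hZ)
      | exact Or.inl (a4 hY hZ)
      | exact Or.inr (b1 hX hY hZ hW) | exact Or.inr (b2 hX hY hZ hW)

end Efficient

theorem OppositeCorners.symm {C D : Set (Set V × Set V)} {p q : Set V × Set V}
    (h : OppositeCorners C D p q) : OppositeCorners D C q p := by
  obtain ⟨p₀, q₀, hp, hq, h1, h2⟩ := h
  refine ⟨q₀.swap, p₀.swap, ?_, ?_, by rwa [corner_comm], ?_⟩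
  · rcases hq with rfl | rfl <;> simp
  · rcases hp with rfl | rfl <;> simp
  · rwa [corner_comm, Prod.swap_swap, Prod.swap_swap]

theorem AllCorners.symm {C D : Set (Set V × Set V)} {p q : Set V × Set V}
    (h : AllCorners C D p q) : AllCorners D C q p := by
  obtain ⟨q₀, rfl | rfl, h1, h2, h3, h4⟩ := h
  · refine ⟨p.swap, Or.inr rfl, ?_, ?_, ?_, ?_⟩ <;> rw [corner_comm] <;> simpa
  · rw [Prod.swap_swap] at h2 h3
    refine ⟨p, Or.inl rfl, ?_, ?_, ?_, ?_⟩ <;> rw [corner_comm] <;> assumption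

/-- The vertex set of the component of `G - X` containing `v`. -/
def compOf (G : SimpleGraph V) (X : Set V) (v : V) : Set V :=
  {u | Relation.ReflTransGen (fun a b => G.Adj a b ∧ b ∉ X) v u}

/-- The set of vertices outside `K` with a neighbour in `K`. -/
def nbhd (G : SimpleGraph V) (K : Set V) : Set V :=
  {u | u ∉ K ∧ ∃ w ∈ K, G.Adj w u}

theorem mem_compOf_self (G : SimpleGraph V) (X : Set V) (v : V) : v ∈ compOf G X v :=
  Relation.ReflTransGen.refl

theorem notMem_of_mem_compOf {G : SimpleGraph V} {X : Set V} {v u : V} (hv : v ∉ X)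
    (hu : u ∈ compOf G X v) : u ∉ X := by
  rcases Relation.ReflTransGen.cases_tail hu with rfl | ⟨_, _, h⟩
  · exact hv
  · exact h.2

theorem nbhd_compOf_subset (G : SimpleGraph V) (X : Set V) (v : V) :
    nbhd G (compOf G X v) ⊆ X := by
  rintro u ⟨hu, w, hw, huw⟩
  by_contra hX
  exact hu (Relation.ReflTransGen.tail hw ⟨huw, hX⟩)

theorem compOf_avoids {G : SimpleGraph V} {X : Set V} {v : V} {q : Set V × Set V}
    (hq : IsSep G q) (h : ∀ u ∈ compOf G X v, u ∈ q.1 → u ∉ q.2) :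
    (∀ u ∈ compOf G X v, u ∉ q.2) ∨ ∀ u ∈ compOf G X v, u ∉ q.1 := by
  have key : ∀ r : Set V × Set V, IsSep G r → (∀ u ∈ compOf G X v, u ∈ r.1 → u ∉ r.2) →
      v ∈ r.1 → ∀ u ∈ compOf G X v, u ∉ r.2 := by
    intro r hr h hv u hu
    induction hu with
    | refl => exact h v (mem_compOf_self G X v) hv
    | @tail b c hb hbc ih =>
      intro hc
      have hc' : c ∈ compOf G X v := Relation.ReflTransGen.tail hb hbc
      exact hr.2 b ⟨(hr.mem_or b).resolve_right ih, ih⟩ c ⟨hc, fun h1 => h c hc' h1 hc⟩ hbc.1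
  rcases hq.mem_or v with hv | hv
  · exact Or.inl (key q hq h hv)
  · exact Or.inr (key q.swap hq.swap (fun u hu h2 h1 => h u hu h1 h2) hv)

theorem nbhd_subset_of_avoids {G : SimpleGraph V} {K : Set V} {q : Set V × Set V}
    (hq : IsSep G q) (h : ∀ u ∈ K, u ∉ q.2) : nbhd G K ⊆ q.1 := by
  rintro u ⟨-, w, hw, huw⟩
  by_contra hu
  exact hq.2 w ⟨(hq.mem_or w).resolve_right (h w hw), h w hw⟩ u
    ⟨(hq.mem_or u).resolve_left hu, hu⟩ huw

/-- `p` separates `X` from the component of `G - X` containing `v`, and its separator is the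
neighbourhood of that component. -/
structure CutsOff (G : SimpleGraph V) (X : Set V) (v : V) (p : Set V × Set V) : Prop where
  isSep : IsSep G p
  subset : X ⊆ p.2
  notMem : ∀ u ∈ compOf G X v, u ∉ p.2
  inter_eq : p.1 ∩ p.2 = nbhd G (compOf G X v)

/-- The separations which cut off `v` from `X` in one of their orientations. -/
def cutOffs (G : SimpleGraph V) (X : Set V) (v : V) : Set (Set V × Set V) :=
  {p | CutsOff G X v p ∨ CutsOff G X v p.swap}

theorem swap_mem_cutOffs {G : SimpleGraph V} {X : Set V} {v : V} {p : Set V × Set V}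
    (hp : p ∈ cutOffs G X v) : p.swap ∈ cutOffs G X v := by
  rcases hp with h | h
  · exact Or.inr (by simpa)
  · exact Or.inl h

theorem cutOffs_nonempty (G : SimpleGraph V) {X : Set V} {v : V} (hv : v ∉ X) :
    (cutOffs G X v).Nonempty := by
  refine ⟨(compOf G X v ∪ nbhd G (compOf G X v), (compOf G X v)ᶜ), Or.inl ⟨⟨?_, ?_⟩, ?_, ?_, ?_⟩⟩
  · ext u
    simp only [Set.mem_union, Set.mem_compl_iff, Set.mem_univ, iff_true]
    tauto
  · rintro a ⟨ha, ha'⟩ b ⟨hb, hb'⟩ hab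
    simp only [Set.mem_compl_iff, not_not, Set.mem_union, not_or] at *
    exact hb'.2 ⟨hb, a, ha', hab⟩
  · exact fun u hu hK => notMem_of_mem_compOf hv hK hu
  · exact fun u hu h => h hu
  · ext u
    simp only [Set.mem_union, Set.mem_compl_iff, Set.mem_inter_iff]
    exact ⟨fun h => h.1.resolve_left h.2, fun h => ⟨Or.inr h, h.1⟩⟩

namespace CutsOff

variable {G : SimpleGraph V} {X Y : Set V} {v u : V} {p q : Set V × Set V}

theorem inter_subset (hp : CutsOff G X v p) : p.1 ∩ p.2 ⊆ X :=
  hp.inter_eq ▸ nbhd_compOf_subset G X v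

theorem corner (hp : CutsOff G X v p) (hq : IsSep G q) (hK : ∀ u ∈ compOf G X v, u ∉ q.2)
    (h : q.1 ∩ q.2 ∩ p.1 ⊆ p.2) : CutsOff G X v (corner p q) := by
  refine ⟨hp.isSep.corner hq, hp.subset.trans Set.subset_union_left, ?_, ?_⟩
  · rintro u hu (h1 | h1)
    · exact hp.notMem u hu h1
    · exact hK u hu h1
  · rw [← hp.inter_eq]
    have := hp.inter_eq ▸ nbhd_subset_of_avoids hq hK
    ext x
    have h1 := @h x
    have h2 := @this x
    simp only [CanonicalTD.corner, Set.mem_inter_iff, Set.mem_union] at *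
    tauto

theorem join (hp : CutsOff G X v p) (hq : IsSep G q) (hX : X ⊆ q.2)
    (h : q.1 ∩ q.2 ∩ p.2 ⊆ p.1) : CutsOff G X v (CanonicalTD.corner p.swap q.swap).swap := by
  refine ⟨(hp.isSep.swap.corner hq.swap).swap, Set.subset_inter hp.subset hX, ?_, ?_⟩
  · rintro u hu ⟨h1, -⟩
    exact hp.notMem u hu h1
  · rw [← hp.inter_eq]
    have := hp.inter_subset.trans hX
    ext x
    have h1 := @h x
    have h2 := @this x
    simp only [CanonicalTD.corner, Set.mem_inter_iff, Set.mem_union, Prod.fst_swap,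
      Prod.snd_swap] at *
    tauto

theorem corner_mem (hp : CutsOff G X v p) (hq : IsSep G q) (hK : ∀ u ∈ compOf G X v, u ∉ q.2)
    (h : q.1 ∩ q.2 ∩ p.1 ⊆ p.2) : CanonicalTD.corner p q ∈ cutOffs G X v :=
  Or.inl (hp.corner hq hK h)

theorem join_mem (hp : CutsOff G X v p) (hq : IsSep G q) (hX : X ⊆ q.2)
    (h : q.1 ∩ q.2 ∩ p.2 ⊆ p.1) : CanonicalTD.corner p.swap q.swap ∈ cutOffs G X v :=
  Or.inr (hp.join hq hX h)

theorem inter_subset_of_avoids (hp : CutsOff G X v p) (hq : IsSep G q)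
    (hK : ∀ u ∈ compOf G X v, u ∉ q.2) : p.1 ∩ p.2 ⊆ q.1 :=
  hp.inter_eq ▸ nbhd_subset_of_avoids hq hK

theorem avoids (hp : CutsOff G X v p) (hq : IsSep G q) (h : q.1 ∩ q.2 ⊆ p.2) :
    (∀ u ∈ compOf G X v, u ∉ q.2) ∨ ∀ u ∈ compOf G X v, u ∉ q.1 :=
  compOf_avoids hq fun u hu h1 h2 => hp.notMem u hu (h ⟨h1, h2⟩)

theorem exists_corners_aux (hp : CutsOff G X v p) (hq : CutsOff G Y u q)
    (hX : X ⊆ q.1) (hY : Y ⊆ p.2) :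
    OppositeCorners (cutOffs G X v) (cutOffs G Y u) p q ∨
      AllCorners (cutOffs G X v) (cutOffs G Y u) p q := by
  have hA := hp.inter_subset
  have hC := hq.inter_subset
  have hAC := hA.trans hX
  have hCB := hC.trans hY
  rcases hp.avoids hq.isSep hCB with hK | hK
  · refine Or.inl ⟨p, q, Or.inl rfl, Or.inl rfl, ?_, ?_⟩
    · exact hp.corner_mem hq.isSep hK fun x hx => hCB hx.1
    · rw [corner_comm]
      exact hq.join_mem hp.isSep hY fun x hx => hAC hx.1
  · have hAD : p.1 ∩ p.2 ⊆ q.2 := hp.inter_subset_of_avoids hq.isSep.swap hK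
    have e1 : CanonicalTD.corner p q.swap ∈ cutOffs G X v :=
      hp.corner_mem hq.isSep.swap hK fun x hx => hCB hx.1.symm
    rcases hq.avoids hp.isSep hAD with hL | hL
    · have hCA : q.1 ∩ q.2 ⊆ p.1 := hq.inter_subset_of_avoids hp.isSep hL
      refine Or.inr ⟨q.swap, Or.inr rfl, e1, ?_, ?_, ?_⟩
      · exact hp.join_mem hq.isSep.swap hX fun x hx => hCA hx.1.symm
      · rw [corner_comm, Prod.swap_swap]
        exact hq.corner_mem hp.isSep hL fun x hx => hAD hx.1
      · rw [corner_comm]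
        exact hq.join_mem hp.isSep hY fun x hx => hAC hx.1
    · refine Or.inl ⟨p, q.swap, Or.inl rfl, Or.inr rfl, e1, ?_⟩
      rw [corner_comm, Prod.swap_swap]
      exact hq.corner_mem hp.isSep.swap hL fun x hx => hAD hx.1.symm

/-- Crossing separations cutting off `v` from `X` and `u` from `Y` can be uncrossed. -/
theorem exists_corners (hp : CutsOff G X v p) (hq : CutsOff G Y u q)
    (hX : X ⊆ q.1 ∨ X ⊆ q.2) (hY : Y ⊆ p.1 ∨ Y ⊆ p.2) :
    OppositeCorners (cutOffs G X v) (cutOffs G Y u) p q ∨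
      AllCorners (cutOffs G X v) (cutOffs G Y u) p q := by
  have hA := hp.inter_subset
  have hC := hq.inter_subset
  rcases hX with hX | hX <;> rcases hY with hY | hY
  · refine Or.inl ⟨p.swap, q, Or.inr rfl, Or.inl rfl, ?_, ?_⟩
    · exact hp.join_mem hq.isSep.swap hX fun x hx => hY (hC hx.1.symm)
    · rw [corner_comm]
      exact hq.join_mem hp.isSep.swap hY fun x hx => hX (hA hx.1.symm)
  · exact hp.exists_corners_aux hq hX hY
  · exact (hq.exists_corners_aux hp hY hX).imp .symm .symm
  · have hCB := hC.trans hY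
    have hAD := hA.trans hX
    rcases hp.avoids hq.isSep hCB with hK | hK
    · have hAC := hp.inter_subset_of_avoids hq.isSep hK
      refine Or.inl ⟨p, q, Or.inl rfl, Or.inl rfl, ?_, ?_⟩
      · exact hp.corner_mem hq.isSep hK fun x hx => hCB hx.1
      · rw [corner_comm]
        exact hq.join_mem hp.isSep hY fun x hx => hAC hx.1
    · rcases hq.avoids hp.isSep hAD with hL | hL
      · have hCA := hq.inter_subset_of_avoids hp.isSep hL
        refine Or.inl ⟨p.swap, q.swap, Or.inr rfl, Or.inr rfl, ?_, ?_⟩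
        · exact hp.join_mem hq.isSep hX fun x hx => hCA hx.1
        · rw [corner_comm, Prod.swap_swap, Prod.swap_swap]
          exact hq.corner_mem hp.isSep hL fun x hx => hAD hx.1
      · refine Or.inl ⟨p, q.swap, Or.inl rfl, Or.inr rfl, ?_, ?_⟩
        · exact hp.corner_mem hq.isSep.swap hK fun x hx => hCB hx.1.symm
        · rw [corner_comm, Prod.swap_swap]
          exact hq.corner_mem hp.isSep.swap hL fun x hx => hAD hx.1.symm

end CutsOff

theorem IsBlock.subset_or {G : SimpleGraph V} {k : ℕ} {X : Set V} (hX : IsBlock G k X)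
    {p : Set V × Set V} (hp : IsSep G p) (h : sepOrder p < k) : X ⊆ p.1 ∨ X ⊆ p.2 :=
  hX.2.1 p hp h

theorem IsBlock.not_subset_inter [Finite V] {G : SimpleGraph V} {k : ℕ} {X : Set V}
    (hX : IsBlock G k X) {p : Set V × Set V} (h : sepOrder p < k) : ¬X ⊆ p.1 ∩ p.2 := by
  intro hs
  have h1 := Set.ncard_le_ncard hs (Set.toFinite _)
  have h2 := hX.1
  unfold sepOrder at h
  omega

theorem IsBlock.exists_isSep {G : SimpleGraph V} {k : ℕ} {X Y : Set V} (hX : IsBlock G k X)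
    (hY : IsBlock G k Y) (hXY : X ≠ Y) :
    ∃ p, IsSep G p ∧ X ⊆ p.1 ∧ Y ⊆ p.2 ∧ sepOrder p < k := by
  by_contra hc
  push Not at hc
  have hins : Inseparable' G k (X ∪ Y) := by
    intro p hp hlt
    rcases hX.subset_or hp hlt with h1 | h1 <;> rcases hY.subset_or hp hlt with h2 | h2
    · exact Or.inl (Set.union_subset h1 h2)
    · exact absurd hlt (hc p hp h1 h2).not_gt
    · have := hc p.swap hp.swap h1 h2
      rw [sepOrder_swap] at this
      exact absurd hlt this.not_gt
    · exact Or.inr (Set.union_subset h1 h2)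
  exact hXY ((hX.2.2 _ hins Set.subset_union_left).symm.trans
    (hY.2.2 _ hins Set.subset_union_right))

theorem IsBlock.exists_efficient {G : SimpleGraph V} {k : ℕ} {X Y : Set V} (hX : IsBlock G k X)
    (hY : IsBlock G k Y) (hXY : X ≠ Y) : ∃ p, Efficient G X Y p := by
  obtain ⟨p, hp, h1, h2, -⟩ := hX.exists_isSep hY hXY
  obtain ⟨q, hq, hmin⟩ := exists_minimalFor_of_wellFoundedLT
    (fun q : Set V × Set V => IsSep G q ∧ X ⊆ q.1 ∧ Y ⊆ q.2) sepOrder ⟨p, hp, h1, h2⟩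
  exact ⟨q, hq.1, hq.2.1, hq.2.2, fun r hr h3 h4 => (le_total _ _).elim id (hmin ⟨hr, h3, h4⟩)⟩

theorem Efficient.sepOrder_lt {G : SimpleGraph V} {k : ℕ} {X Y : Set V} {p : Set V × Set V}
    (hp : Efficient G X Y p) (hX : IsBlock G k X) (hY : IsBlock G k Y) (hXY : X ≠ Y) :
    sepOrder p < k := by
  obtain ⟨q, hq, h1, h2, h3⟩ := hX.exists_isSep hY hXY
  exact (hp.le q hq h1 h2).trans_lt h3

theorem Efficient.corner_of_inter_subset [Finite V] {G : SimpleGraph V} {X Y : Set V}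
    {p q : Set V × Set V} (hq : Efficient G X Y q) (hp : IsSep G p) (h : p.1 ∩ p.2 ⊆ q.2)
    (hX : X ⊆ p.1) : Efficient G X Y (CanonicalTD.corner p q) := by
  refine hq.of_le (hp.corner hq.isSep) (Set.subset_inter hX hq.left)
    (hq.right.trans Set.subset_union_right) (Set.ncard_le_ncard ?_ (Set.toFinite _))
  rintro x ⟨⟨h1, h2⟩, h3 | h3⟩
  · exact ⟨h2, h ⟨h1, h3⟩⟩
  · exact ⟨h2, h3⟩

/-- The optimal separations of order `< k` cutting off vertices from `k`-blocks. -/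
def cutOffSystem (G : SimpleGraph V) (k : ℕ) : Set (Set V × Set V) :=
  {p | ∃ X v, IsBlock G k X ∧ v ∉ X ∧ (nbhd G (compOf G X v)).ncard < k ∧
    p ∈ crossMin (cutOffs G X v)}

theorem swap_mem_cutOffSystem {G : SimpleGraph V} {k : ℕ} {p : Set V × Set V}
    (hp : p ∈ cutOffSystem G k) : p.swap ∈ cutOffSystem G k := by
  obtain ⟨X, v, h1, h2, h3, h4⟩ := hp
  exact ⟨X, v, h1, h2, h3, swap_mem_crossMin (fun _ => swap_mem_cutOffs) h4⟩

theorem mem_cutOffSystem_cases {G : SimpleGraph V} {k : ℕ} {p : Set V × Set V}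
    (hp : p ∈ cutOffSystem G k) : ∃ X v, IsBlock G k X ∧ v ∉ X ∧ ∃ p₀, (p = p₀ ∨ p = p₀.swap) ∧
      CutsOff G X v p₀ ∧ p₀ ∈ crossMin (cutOffs G X v) ∧ sepOrder p₀ < k := by
  obtain ⟨X, v, h1, h2, h3, h4⟩ := hp
  rcases h4.1 with h | h
  · exact ⟨X, v, h1, h2, p, Or.inl rfl, h, h4, by rwa [sepOrder, h.inter_eq]⟩
  · exact ⟨X, v, h1, h2, p.swap, Or.inr (by simp), h,
      swap_mem_crossMin (fun _ => swap_mem_cutOffs) h4, by rwa [sepOrder, h.inter_eq]⟩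

theorem nested_cutOffSystem [Finite V] (G : SimpleGraph V) (k : ℕ) :
    NestedSystem (cutOffSystem G k) := by
  intro p hp q hq
  obtain ⟨X, v, hX, hv, p₀, hpp, hp₀, hpm, hplt⟩ := mem_cutOffSystem_cases hp
  obtain ⟨Y, u, hY, hu, q₀, hqq, hq₀, hqm, hqlt⟩ := mem_cutOffSystem_cases hq
  have : Nested p₀ q₀ := nested_of_mem_crossMin hpm hqm fun _ =>
    hp₀.exists_corners hq₀ (hX.subset_or hq₀.isSep hqlt) (hY.subset_or hp₀.isSep hplt)
  rcases hpp with rfl | rfl <;> rcases hqq with rfl | rfl <;> simpa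

theorem ProperSep.swap {p : Set V × Set V} (hp : ProperSep p) : ProperSep p.swap :=
  ⟨hp.2, hp.1⟩

theorem mem_Sk_of_mem_cutOffSystem [Finite V] {G : SimpleGraph V} {k : ℕ} {p : Set V × Set V}
    (hp : p ∈ cutOffSystem G k) : p ∈ Sk G k := by
  obtain ⟨X, v, hX, hv, p₀, hpp, hp₀, hpm, hplt⟩ := mem_cutOffSystem_cases hp
  have hprop : ProperSep p₀ := by
    constructor
    · have := hp₀.notMem v (mem_compOf_self G X v)
      exact ⟨v, (hp₀.isSep.mem_or v).resolve_right this, this⟩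
    · by_contra hc
      rw [Set.not_nonempty_iff_eq_empty, Set.sdiff_eq_empty] at hc
      exact hX.not_subset_inter hplt (Set.subset_inter (hp₀.subset.trans hc) hp₀.subset)
  rcases hpp with rfl | rfl
  · exact ⟨hp₀.isSep, hprop, hplt⟩
  · exact ⟨hp₀.isSep.swap, hprop.swap, by rwa [sepOrder_swap]⟩

/-- The efficient separations of `X` and `Y` nested with `cutOffSystem G k`. -/
def nestedEfficient (G : SimpleGraph V) (k : ℕ) (X Y : Set V) : Set (Set V × Set V) :=
  {p | (Efficient G X Y p ∨ Efficient G Y X p) ∧ ∀ s ∈ cutOffSystem G k, Nested s p}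

theorem swap_mem_nestedEfficient {G : SimpleGraph V} {k : ℕ} {X Y : Set V} {p : Set V × Set V}
    (hp : p ∈ nestedEfficient G k X Y) : p.swap ∈ nestedEfficient G k X Y :=
  ⟨hp.1.symm.imp .swap .swap, fun s hs => by simpa using hp.2 s hs⟩

theorem nestedEfficient_nonempty [Finite V] {G : SimpleGraph V} {k : ℕ} {X Y : Set V}
    (hX : IsBlock G k X) (hY : IsBlock G k Y) (hXY : X ≠ Y) :
    (nestedEfficient G k X Y).Nonempty := by
  obtain ⟨p, hp⟩ := hX.exists_efficient hY hXY
  obtain ⟨q, hq, hmin⟩ := exists_minimalFor_of_wellFoundedLT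
    (fun q => Efficient G X Y q ∨ Efficient G Y X q)
    (fun q => {s | s ∈ cutOffSystem G k ∧ ¬Nested s q}.ncard) ⟨p, Or.inl hp⟩
  refine ⟨q, hq, fun s hs => ?_⟩
  by_contra hsq
  have key : ∀ q₀ s₀ : Set V × Set V, (q₀ = q ∨ q₀ = q.swap) → (s₀ = s ∨ s₀ = s.swap) →
      ¬(Efficient G X Y (corner s₀ q₀) ∨ Efficient G Y X (corner s₀ q₀)) := by
    intro q₀ s₀ hq₀ hs₀ hc
    have hs₀m : s₀ ∈ cutOffSystem G k := by
      rcases hs₀ with rfl | rfl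
      · exact hs
      · exact swap_mem_cutOffSystem hs
    have hq₀s : ¬Nested s₀ q₀ := by
      rcases hs₀ with rfl | rfl <;> rcases hq₀ with rfl | rfl <;> simpa
    have hq₀c : ∀ r, Nested r q₀ ↔ Nested r q := by
      rcases hq₀ with rfl | rfl <;> simp
    have hle := hmin (j := corner s₀ q₀) hc
    have hlt : {r | r ∈ cutOffSystem G k ∧ ¬Nested r (corner s₀ q₀)}.ncard <
        {r | r ∈ cutOffSystem G k ∧ ¬Nested r q}.ncard := by
      refine Set.ncard_lt_ncard ⟨?_, fun h => ?_⟩ (Set.toFinite _)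
      · rintro r ⟨hr, hrc⟩
        refine ⟨hr, fun hn => hrc ?_⟩
        exact nested_corner_of_nested (nested_cutOffSystem G k r hr s₀ hs₀m) ((hq₀c r).2 hn) hq₀s
      · exact (h (a := s₀) ⟨hs₀m, by rwa [← hq₀c]⟩).2 (nested_corner_left s₀ q₀)
    exact absurd (hle hlt.le) hlt.not_ge
  obtain ⟨Z, v, hZ, hv, s₀, hss, hs₀, -, hslt⟩ := mem_cutOffSystem_cases hs
  have e1 : s₀ = s ∨ s₀ = s.swap := by rcases hss with rfl | rfl <;> simp
  have e2 : s₀.swap = s ∨ s₀.swap = s.swap := by rcases hss with rfl | rfl <;> simp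
  have main : ∀ A B : Set V, IsBlock G k A → ∀ q₀, (q₀ = q ∨ q₀ = q.swap) → Efficient G A B q₀ →
      Z ⊆ q₀.2 → ∃ s₁, (s₁ = s ∨ s₁ = s.swap) ∧ Efficient G A B (corner s₁ q₀) := by
    intro A B hA q₀ hq₀ hef hZq
    rcases hA.subset_or hs₀.isSep hslt with h | h
    · exact ⟨s₀, e1, hef.corner_of_inter_subset hs₀.isSep (hs₀.inter_subset.trans hZq) h⟩
    · refine ⟨s₀.swap, e2, hef.corner_of_inter_subset hs₀.isSep.swap ?_ h⟩
      exact fun x hx => hZq (hs₀.inter_subset hx.symm)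
  have qlt : sepOrder q < k := by
    rcases hq with hq | hq
    · exact hq.sepOrder_lt hX hY hXY
    · exact hq.sepOrder_lt hY hX hXY.symm
  have qsep : IsSep G q := hq.elim Efficient.isSep Efficient.isSep
  have o1 : q = q ∨ q = q.swap := Or.inl rfl
  have o2 : q.swap = q ∨ q.swap = q.swap := Or.inr rfl
  rcases hZ.subset_or qsep qlt with h | h <;> rcases hq with hq | hq
  · obtain ⟨s₁, h1, h2⟩ := main Y X hY q.swap o2 hq.swap h
    exact key _ _ o2 h1 (Or.inr h2)
  · obtain ⟨s₁, h1, h2⟩ := main X Y hX q.swap o2 hq.swap h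
    exact key _ _ o2 h1 (Or.inl h2)
  · obtain ⟨s₁, h1, h2⟩ := main X Y hX q o1 hq h
    exact key _ _ o1 h1 (Or.inl h2)
  · obtain ⟨s₁, h1, h2⟩ := main Y X hY q o1 hq h
    exact key _ _ o1 h1 (Or.inr h2)

/-- The optimal separations distinguishing two `k`-blocks efficiently. -/
def distinguishingSystem (G : SimpleGraph V) (k : ℕ) : Set (Set V × Set V) :=
  {p | ∃ X Y, IsBlock G k X ∧ IsBlock G k Y ∧ X ≠ Y ∧ p ∈ crossMin (nestedEfficient G k X Y)}

theorem mem_distinguishingSystem_cases {G : SimpleGraph V} {k : ℕ} {p : Set V × Set V}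
    (hp : p ∈ distinguishingSystem G k) : ∃ X Y, IsBlock G k X ∧ IsBlock G k Y ∧ X ≠ Y ∧
      Efficient G X Y p ∧ sepOrder p < k ∧ p ∈ crossMin (nestedEfficient G k X Y) := by
  obtain ⟨X, Y, hX, hY, hXY, hm⟩ := hp
  rcases hm.1.1 with h | h
  · exact ⟨X, Y, hX, hY, hXY, h, h.sepOrder_lt hX hY hXY, hm⟩
  · refine ⟨Y, X, hY, hX, hXY.symm, h, h.sepOrder_lt hY hX hXY.symm, ?_⟩
    have : nestedEfficient G k Y X = nestedEfficient G k X Y := by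
      ext r
      simp only [nestedEfficient, or_comm]
    rwa [this]

theorem swap_mem_distinguishingSystem {G : SimpleGraph V} {k : ℕ} {p : Set V × Set V}
    (hp : p ∈ distinguishingSystem G k) : p.swap ∈ distinguishingSystem G k := by
  obtain ⟨X, Y, h1, h2, h3, h4⟩ := hp
  exact ⟨X, Y, h1, h2, h3, swap_mem_crossMin (fun _ => swap_mem_nestedEfficient) h4⟩

theorem mem_Sk_of_mem_distinguishingSystem [Finite V] {G : SimpleGraph V} {k : ℕ}
    {p : Set V × Set V} (hp : p ∈ distinguishingSystem G k) : p ∈ Sk G k := by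
  obtain ⟨X, Y, hX, hY, hXY, hef, hlt, -⟩ := mem_distinguishingSystem_cases hp
  refine ⟨hef.isSep, ⟨?_, ?_⟩, hlt⟩
  · by_contra hc
    rw [Set.not_nonempty_iff_eq_empty, Set.sdiff_eq_empty] at hc
    exact hX.not_subset_inter hlt (Set.subset_inter hef.left (hef.left.trans hc))
  · by_contra hc
    rw [Set.not_nonempty_iff_eq_empty, Set.sdiff_eq_empty] at hc
    exact hY.not_subset_inter hlt (Set.subset_inter (hef.right.trans hc) hef.right)

theorem nested_distinguishingSystem [Finite V] (G : SimpleGraph V) (k : ℕ) :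
    NestedSystem (distinguishingSystem G k) := by
  intro p hp q hq
  obtain ⟨X, Y, hX, hY, hXY, hpe, hplt, hpm⟩ := mem_distinguishingSystem_cases hp
  obtain ⟨Z, W, hZ, hW, hZW, hqe, hqlt, hqm⟩ := mem_distinguishingSystem_cases hq
  refine nested_of_mem_crossMin hpm hqm fun hn => ?_
  have hnest : ∀ p₀ q₀, (p₀ = p ∨ p₀ = p.swap) → (q₀ = q ∨ q₀ = q.swap) →
      ∀ s ∈ cutOffSystem G k, Nested s (corner p₀ q₀) := by
    intro p₀ q₀ h1 h2 s hs
    have e1 := hpm.1.2 s hs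
    have e2 := hqm.1.2 s hs
    refine nested_corner_of_nested ?_ ?_ ?_
    · rcases h1 with rfl | rfl <;> simpa
    · rcases h2 with rfl | rfl <;> simpa
    · rcases h1 with rfl | rfl <;> rcases h2 with rfl | rfl <;> simpa
  exact hpe.exists_corners hqe (hX.subset_or hqe.isSep hqlt) (hY.subset_or hqe.isSep hqlt)
    (hZ.subset_or hpe.isSep hplt) (hW.subset_or hpe.isSep hplt)
    (fun p₀ q₀ h1 h2 h => ⟨h, hnest p₀ q₀ h1 h2⟩) (fun p₀ q₀ h1 h2 h => ⟨h, hnest p₀ q₀ h1 h2⟩)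

theorem nested_cutOffSystem_union_distinguishingSystem [Finite V] (G : SimpleGraph V) (k : ℕ) :
    NestedSystem (cutOffSystem G k ∪ distinguishingSystem G k) := by
  rintro p (hp | hp) q (hq | hq)
  · exact nested_cutOffSystem G k p hp q hq
  · obtain ⟨X, Y, -, -, -, h⟩ := hq
    exact h.1.2 p hp
  · obtain ⟨X, Y, -, -, -, h⟩ := hp
    exact (h.1.2 q hq).symm
  · exact nested_distinguishingSystem G k p hp q hq

section Automorphisms

variable {G : SimpleGraph V}

theorem IsSep.mapSep {p : Set V × Set V} (hp : IsSep G p) (φ : G ≃g G) :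
    IsSep G (mapSep φ p) := by
  constructor
  · change φ '' p.1 ∪ φ '' p.2 = univ
    rw [← Set.image_union, hp.1, Set.image_univ, φ.surjective.range_eq]
  · change ∀ a ∈ φ '' p.1 \ φ '' p.2, ∀ b ∈ φ '' p.2 \ φ '' p.1, ¬G.Adj a b
    rw [← Set.image_sdiff φ.injective, ← Set.image_sdiff φ.injective]
    rintro _ ⟨a, ha, rfl⟩ _ ⟨b, hb, rfl⟩ hab
    exact hp.2 a ha b hb (φ.map_adj_iff.1 hab)

theorem mapSep_inter (φ : G ≃g G) (p : Set V × Set V) :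
    (mapSep φ p).1 ∩ (mapSep φ p).2 = φ '' (p.1 ∩ p.2) :=
  (Set.image_inter φ.injective).symm

theorem sepOrder_mapSep (φ : G ≃g G) (p : Set V × Set V) :
    sepOrder (mapSep φ p) = sepOrder p := by
  rw [sepOrder, mapSep_inter, Set.ncard_image_of_injective _ φ.injective, sepOrder]

theorem nested_mapSep (φ : G ≃g G) {p q : Set V × Set V} :
    Nested (mapSep φ p) (mapSep φ q) ↔ Nested p q := by
  simp only [Nested, ← mapSep_swap, sepLE_mapSep]

theorem mapSep_injective (φ : G ≃g G) : Function.Injective (mapSep φ) := fun p q h => by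
  rw [← mapSep_symm φ p, h, mapSep_symm]

theorem crossingNumber_mapSep (φ : G ≃g G) (p : Set V × Set V) :
    crossingNumber (mapSep φ p) = crossingNumber p := by
  have : {r | ¬Nested r (mapSep φ p)} = mapSep φ '' {r | ¬Nested r p} := by
    ext r
    constructor
    · intro hr
      refine ⟨mapSep φ.symm r, fun h => hr ?_, mapSep_symm' φ r⟩
      rw [← nested_mapSep φ, mapSep_symm'] at h
      exact h
    · rintro ⟨s, hs, rfl⟩ h
      exact hs ((nested_mapSep φ).1 h)
  rw [crossingNumber, this, Set.ncard_image_of_injective _ (mapSep_injective φ), crossingNumber]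

theorem mapSep_mem_crossMin (φ : G ≃g G) {C D : Set (Set V × Set V)}
    (h1 : ∀ p ∈ C, mapSep φ p ∈ D) (h2 : ∀ p ∈ D, mapSep φ.symm p ∈ C) {p : Set V × Set V}
    (hp : p ∈ crossMin C) : mapSep φ p ∈ crossMin D := by
  refine ⟨h1 p hp.1, fun q hq => ?_⟩
  rw [crossingNumber_mapSep, ← crossingNumber_mapSep φ.symm q]
  exact hp.2 _ (h2 q hq)

@[simp] theorem symm_image_image (φ : G ≃g G) (X : Set V) : φ.symm '' (φ '' X) = X := by
  simp [Set.image_image]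

@[simp] theorem image_symm_image (φ : G ≃g G) (X : Set V) : φ '' (φ.symm '' X) = X := by
  simp [Set.image_image]

theorem Inseparable'.image {k : ℕ} {X : Set V} (hX : Inseparable' G k X) (φ : G ≃g G) :
    Inseparable' G k (φ '' X) := by
  intro p hp hlt
  refine (hX (mapSep φ.symm p) (hp.mapSep _) (by rwa [sepOrder_mapSep])).imp ?_ ?_ <;>
  · intro h
    have := Set.image_mono (f := φ) h
    rwa [mapSep, image_symm_image] at this

theorem IsBlock.image {k : ℕ} {X : Set V} (hX : IsBlock G k X) (φ : G ≃g G) :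
    IsBlock G k (φ '' X) := by
  refine ⟨by rw [Set.ncard_image_of_injective _ φ.injective]; exact hX.1, hX.2.1.image φ, ?_⟩
  intro Y hY hXY
  have h := hX.2.2 _ (hY.image φ.symm) (by
    have := Set.image_mono (f := φ.symm) hXY
    rwa [symm_image_image] at this)
  rw [← h, image_symm_image]

theorem compOf_image (φ : G ≃g G) (X : Set V) (v : V) :
    compOf G (φ '' X) (φ v) = φ '' compOf G X v := by
  have key : ∀ (ψ : G ≃g G) (Y : Set V) (u w : V), w ∈ compOf G Y u →
      ψ w ∈ compOf G (ψ '' Y) (ψ u) := by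
    intro ψ Y u w hw
    refine Relation.ReflTransGen.lift ψ (fun a b hab => ⟨ψ.map_adj_iff.2 hab.1, ?_⟩) _ _ hw
    rw [ψ.injective.mem_set_image]
    exact hab.2
  ext u
  constructor
  · intro hu
    refine ⟨φ.symm u, ?_, by simp⟩
    simpa using key φ.symm _ _ _ hu
  · rintro ⟨w, hw, rfl⟩
    exact key φ X v w hw

theorem nbhd_image (φ : G ≃g G) (K : Set V) : nbhd G (φ '' K) = φ '' nbhd G K := by
  ext u
  obtain ⟨u, rfl⟩ := φ.surjective u
  rw [φ.injective.mem_set_image]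
  simp only [nbhd, Set.mem_ofPred_eq, φ.injective.mem_set_image, Set.exists_mem_image,
    SimpleGraph.Iso.map_adj_iff]

theorem CutsOff.mapSep {X : Set V} {v : V} {p : Set V × Set V} (hp : CutsOff G X v p)
    (φ : G ≃g G) : CutsOff G (φ '' X) (φ v) (mapSep φ p) := by
  refine ⟨hp.isSep.mapSep φ, Set.image_mono hp.subset, ?_, ?_⟩
  · rw [compOf_image]
    rintro _ ⟨u, hu, rfl⟩ h
    exact hp.notMem u hu (φ.injective.mem_set_image.1 h)
  · rw [mapSep_inter, hp.inter_eq, compOf_image, nbhd_image]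

theorem mapSep_mem_cutOffs (φ : G ≃g G) {X : Set V} {v : V} {p : Set V × Set V}
    (hp : p ∈ cutOffs G X v) : mapSep φ p ∈ cutOffs G (φ '' X) (φ v) :=
  hp.imp (fun h => h.mapSep φ) fun h => h.mapSep φ

theorem mapSep_mem_cutOffSystem (φ : G ≃g G) {k : ℕ} {p : Set V × Set V}
    (hp : p ∈ cutOffSystem G k) : mapSep φ p ∈ cutOffSystem G k := by
  obtain ⟨X, v, hX, hv, hlt, hm⟩ := hp
  refine ⟨φ '' X, φ v, hX.image φ, ?_, ?_, ?_⟩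
  · rwa [φ.injective.mem_set_image]
  · rwa [compOf_image, nbhd_image, Set.ncard_image_of_injective _ φ.injective]
  · refine mapSep_mem_crossMin φ (fun q hq => mapSep_mem_cutOffs φ hq) (fun q hq => ?_) hm
    simpa using mapSep_mem_cutOffs φ.symm hq

theorem Efficient.mapSep {X Y : Set V} {p : Set V × Set V} (hp : Efficient G X Y p)
    (φ : G ≃g G) : Efficient G (φ '' X) (φ '' Y) (mapSep φ p) := by
  refine ⟨hp.isSep.mapSep φ, Set.image_mono hp.left, Set.image_mono hp.right, ?_⟩
  intro q hq h1 h2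
  rw [sepOrder_mapSep, ← sepOrder_mapSep φ.symm q]
  refine hp.le _ (hq.mapSep _) ?_ ?_
  · have := Set.image_mono (f := φ.symm) h1
    rwa [symm_image_image] at this
  · have := Set.image_mono (f := φ.symm) h2
    rwa [symm_image_image] at this

theorem mapSep_mem_nestedEfficient (φ : G ≃g G) {k : ℕ} {X Y : Set V} {p : Set V × Set V}
    (hp : p ∈ nestedEfficient G k X Y) :
    mapSep φ p ∈ nestedEfficient G k (φ '' X) (φ '' Y) := by
  refine ⟨hp.1.imp (fun h => h.mapSep φ) fun h => h.mapSep φ, fun s hs => ?_⟩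
  have := hp.2 _ (mapSep_mem_cutOffSystem φ.symm hs)
  rwa [← nested_mapSep φ, mapSep_symm'] at this

theorem mapSep_mem_distinguishingSystem (φ : G ≃g G) {k : ℕ} {p : Set V × Set V}
    (hp : p ∈ distinguishingSystem G k) : mapSep φ p ∈ distinguishingSystem G k := by
  obtain ⟨X, Y, hX, hY, hXY, hm⟩ := hp
  refine ⟨φ '' X, φ '' Y, hX.image φ, hY.image φ, fun h => hXY ?_, ?_⟩
  · exact φ.injective.image_injective h
  · refine mapSep_mem_crossMin φ (fun q hq => mapSep_mem_nestedEfficient φ hq)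
      (fun q hq => ?_) hm
    simpa using mapSep_mem_nestedEfficient φ.symm hq

end Automorphisms

section Parts

variable {G : SimpleGraph V} {T : SimpleGraph ι} {Vt : ι → Set V}

theorem mem_side_or_mem_side (hT : T.Connected) (t u s : ι) : s ∈ side T t u ∨ s ∈ side T u t := by
  obtain ⟨w⟩ := hT.preconnected s t
  induction w with
  | nil => exact Or.inl (Reachable.refl _)
  | @cons a b c h w ih =>
    by_cases he : s(a, b) = s(c, u)
    · rcases Sym2.eq_iff.1 he with ⟨rfl, -⟩ | ⟨rfl, -⟩
      · exact Or.inl (Reachable.refl _)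
      · exact Or.inr (Reachable.refl _)
    · refine ih.imp (fun hb => hb.trans (Adj.reachable ?_)) fun hb => hb.trans (Adj.reachable ?_)
      · rw [deleteEdges_adj]
        exact ⟨h.symm, fun hs => he (by rw [Sym2.eq_swap]; exact hs)⟩
      · rw [deleteEdges_adj, Sym2.eq_swap (a := u)]
        exact ⟨h.symm, fun hs => he (by rw [Sym2.eq_swap]; exact hs)⟩

theorem mem_edges_of_mem_side (hT : T.IsAcyclic) {t u s s' : ι} (htu : T.Adj t u)
    (hs : s ∈ side T t u) (hs' : s' ∈ side T u t) (w : T.Walk s s') : s(t, u) ∈ w.edges := by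
  by_contra hc
  have hb := isBridge_iff.1 (isAcyclic_iff_forall_adj_isBridge.1 hT htu)
  have hs'' : (T.deleteEdges {s(t, u)}).Reachable u s' := by
    rw [Sym2.eq_swap]; exact hs'
  exact hb ((hs.trans (w.toDeleteEdge _ hc).reachable).trans hs''.symm)

theorem IsTreeDecomp.inducedSep_inter_subset (h : IsTreeDecomp G T Vt) {t u : ι}
    (htu : T.Adj t u) :
    (inducedSep T Vt t u).1 ∩ (inducedSep T Vt t u).2 ⊆ Vt t ∩ Vt u := by
  rintro x ⟨hx1, hx2⟩
  simp only [inducedSep, Set.mem_iUnion, exists_prop] at hx1 hx2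
  obtain ⟨s, hs, hx1⟩ := hx1
  obtain ⟨s', hs', hx2⟩ := hx2
  obtain ⟨w, hw, -⟩ := h.1.existsUnique_path s s'
  have he := mem_edges_of_mem_side h.1.isAcyclic htu hs hs' w
  exact ⟨h.2.2.2 s s' w hw t (w.fst_mem_support_of_mem_edges he) ⟨hx1, hx2⟩,
    h.2.2.2 s s' w hw u (w.snd_mem_support_of_mem_edges he) ⟨hx1, hx2⟩⟩

theorem subset_inducedSep_or (hT : T.Connected) (Vt : ι → Set V) (t u s : ι) :
    Vt s ⊆ (inducedSep T Vt t u).1 ∨ Vt s ⊆ (inducedSep T Vt t u).2 :=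
  (mem_side_or_mem_side hT t u s).imp (fun h => Set.subset_biUnion_of_mem h)
    fun h => Set.subset_biUnion_of_mem h

theorem IsTreeDecomp.isSep_inducedSep (h : IsTreeDecomp G T Vt) (t u : ι) :
    IsSep G (inducedSep T Vt t u) := by
  constructor
  · rw [Set.eq_univ_iff_forall]
    intro v
    obtain ⟨s, hs⟩ := Set.mem_iUnion.1 (h.2.1 ▸ Set.mem_univ v : v ∈ ⋃ t, Vt t)
    exact (subset_inducedSep_or h.1.connected Vt t u s).imp (fun h => h hs) fun h => h hs
  · rintro a ⟨-, ha⟩ b ⟨-, hb⟩ hab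
    obtain ⟨s, hs1, hs2⟩ := h.2.2.1 a b hab
    rcases subset_inducedSep_or h.1.connected Vt t u s with hs | hs
    · exact hb (hs hs2)
    · exact ha (hs hs1)

theorem IsTreeDecomp.ncard_nbhd_compOf_lt [Finite V] (h : IsTreeDecomp G T Vt) {k : ℕ}
    (hk : AdhesionLt T Vt k) {t : ι} {v : V} (hv : v ∉ Vt t) :
    (nbhd G (compOf G (Vt t) v)).ncard < k := by
  obtain ⟨s, hs⟩ := Set.mem_iUnion.1 (h.2.1 ▸ Set.mem_univ v : v ∈ ⋃ t, Vt t)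
  obtain ⟨w, hw, -⟩ := h.1.existsUnique_path t s
  cases w with
  | nil => exact absurd hs hv
  | @cons _ u _ htu w =>
    have hsu : s ∈ side T u t :=
      (w.toDeleteEdge s(u, t) fun he =>
        (Walk.cons_isPath_iff _ _).1 hw |>.2 (w.snd_mem_support_of_mem_edges he)).reachable
    have hsep := h.isSep_inducedSep u t
    have hint := h.inducedSep_inter_subset htu.symm
    have hvq : v ∈ (inducedSep T Vt u t).1 := Set.mem_biUnion hsu hs
    have htq : Vt t ⊆ (inducedSep T Vt u t).2 :=
      Set.subset_biUnion_of_mem (u := Vt) (show t ∈ side T t u from Reachable.refl _)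
    refine (Set.ncard_le_ncard ?_ (Set.toFinite _)).trans_lt (hk u t htu.symm)
    refine subset_trans (Set.subset_inter ?_ ((nbhd_compOf_subset G _ v).trans htq)) hint
    rcases compOf_avoids hsep fun x hx h1 h2 =>
      notMem_of_mem_compOf hv hx (hint ⟨h1, h2⟩).2 with hK | hK
    · exact nbhd_subset_of_avoids hsep hK
    · exact absurd hvq (hK v (mem_compOf_self G _ v))

end Parts

/-- Corollary 3.3: every finite graph has a good tree-decomposition that includes among
its parts all `k`-blocks that are a part in some tree-decomposition of adhesion `< k`. -/
theorem stmt_9 {V : Type*} [Fintype V] (G : SimpleGraph V) (k : ℕ) :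
    ∃ (ι : Type) (_ : Fintype ι) (T : SimpleGraph ι) (Vt : ι → Set V),
      IsTreeDecomp G T Vt ∧ Canonical G T Vt ∧ AdhesionLt T Vt k ∧
      DistinguishesBlocksEff G k T Vt ∧
      ∀ X : Set V, IsBlock G k X →
        (∃ (ι' : Type) (_ : Fintype ι') (T' : SimpleGraph ι') (Vt' : ι' → Set V),
          IsTreeDecomp G T' Vt' ∧ AdhesionLt T' Vt' k ∧ ∃ t' : ι', Vt' t' = X) →
        ∃ t : ι, Vt t = X := by
  obtain ⟨ι, hι, T, Vt, h1, h2, h3, h4, h5⟩ := exists_treeDecomp_of_nestedSystem G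
    (cutOffSystem G k ∪ distinguishingSystem G k)
    ⟨fun p hp => (hp.elim mem_Sk_of_mem_cutOffSystem mem_Sk_of_mem_distinguishingSystem).1,
      fun p hp => hp.imp swap_mem_cutOffSystem swap_mem_distinguishingSystem⟩
    (nested_cutOffSystem_union_distinguishingSystem G k)
    (fun p hp => (hp.elim mem_Sk_of_mem_cutOffSystem mem_Sk_of_mem_distinguishingSystem).2.1)
    (fun φ p hp => hp.imp (mapSep_mem_cutOffSystem φ) (mapSep_mem_distinguishingSystem φ))
  refine ⟨ι, hι, T, Vt, h1, h2, ?_, ?_, ?_⟩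
  · intro t u htu
    obtain ⟨p, hp, hsub⟩ := h3 t u htu
    exact (Set.ncard_le_ncard hsub (Set.toFinite _)).trans_lt
      (hp.elim mem_Sk_of_mem_cutOffSystem mem_Sk_of_mem_distinguishingSystem).2.2
  · intro X Y hX hY hXY
    obtain ⟨p, hp⟩ := crossMin_nonempty (nestedEfficient_nonempty hX hY hXY)
    have hpD : p ∈ distinguishingSystem G k := ⟨X, Y, hX, hY, hXY, hp⟩
    rcases hp.1.1 with he | he
    · exact ⟨p, h4 (Or.inr hpD), he.left, he.right, he.le⟩
    · exact ⟨p.swap, h4 (Or.inr (swap_mem_distinguishingSystem hpD)), he.right, he.left,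
        he.swap.le⟩
  · rintro X hX ⟨ι', -, T', Vt', h', hk', t', rfl⟩
    obtain ⟨t, ht, hmin⟩ := h5 (Vt' t') fun p hp =>
      have hp' := hp.elim mem_Sk_of_mem_cutOffSystem mem_Sk_of_mem_distinguishingSystem
      hX.subset_or hp'.1 hp'.2.2
    refine ⟨t, Set.Subset.antisymm (fun v hv => ?_) ht⟩
    by_contra hvX
    have hlt := h'.ncard_nbhd_compOf_lt hk' hvX
    obtain ⟨p, hp⟩ := crossMin_nonempty (cutOffs_nonempty G hvX)
    have hpS : p ∈ cutOffSystem G k := ⟨Vt' t', v, hX, hvX, hlt, hp⟩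
    have key : ∀ q ∈ cutOffSystem G k, CutsOff G (Vt' t') v q → False := by
      intro q hq hc
      refine hc.notMem v (mem_compOf_self G _ v) (hmin q (Or.inl hq) (fun h => ?_) hv)
      exact hX.not_subset_inter (mem_Sk_of_mem_cutOffSystem hq).2.2 (Set.subset_inter h hc.subset)
    rcases hp.1 with hc | hc
    · exact key p hpS hc
    · exact key _ (swap_mem_cutOffSystem hpS) hc

end CanonicalTD
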